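/- Let J be a real analytic almost complex structure on a neighborhood of 0 in ℝ^{2n} with J(0) = J₀ which is integrable, i.e. [JX,JY] − J[JX,Y] − J[X,JY] − [X,Y] = 0 for all smooth vector fields X, Y (vanishing Nijenhuis tensor). Let M = {φ = 0} with 0 ∈ M, and let X be a real analytic vector field near 0 belonging to ker 𝓛. Then there is a neighborhood V of 0 such that for every p ∈ M ∩ V there exist ρ > 0 and a real analytic J-holomorphic map γ : {ζ ∈ ℂ : |ζ| < ρ} → ℝ^{2n} with γ(0) = p, ∂γ/∂x(0) = X(p), and γ({|ζ| < ρ}) ⊆ M. -/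

import Mathlib

noncomputable section

open Metric

/-- `ℝ^{2n}` identified with `ℂ^n`. -/
abbrev Ecx (n : ℕ) := EuclideanSpace ℂ (Fin n)

/-- The standard complex structure `J₀` (multiplication by `i`), as a real-linear map. -/
def J0 (n : ℕ) : Ecx n →L[ℝ] Ecx n := Complex.I • ContinuousLinearMap.id ℝ (Ecx n)

variable {F : Type*} [NormedAddCommGroup F] [NormedSpace ℝ F]

/-- `J`-holomorphy of `γ` on a set `D ⊆ ℂ`: `dγ(ζ) ∘ J_st = J(γ ζ) ∘ dγ(ζ)`. -/
def JHolOn (J : F → F →L[ℝ] F) (D : Set ℂ) (γ : ℂ → F) : Prop :=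
  ∀ ζ ∈ D, ∀ v : ℂ, fderiv ℝ γ ζ (Complex.I * v) = J (γ ζ) (fderiv ℝ γ ζ v)


/-- Lie bracket of vector fields: `[X,Y](p) = dY(p)(X(p)) − dX(p)(Y(p))`. -/
def lieVF (X Y : F → F) : F → F :=
  fun p => fderiv ℝ Y p (X p) - fderiv ℝ X p (Y p)

/-- The vector field `JX : x ↦ J(x) X(x)`. -/
def Jvf (J : F → F →L[ℝ] F) (X : F → F) : F → F := fun p => J p (X p)

/-- The flat covariant derivative `X · Y : p ↦ dY(p)(X(p))`. -/
def derVF (X Y : F → F) : F → F := fun p => fderiv ℝ Y p (X p)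

/-- `DX X Y k = D_X^{k,0} Y = X·(X·(⋯(X·Y)))` (`k` times). -/
def DX (X Y : F → F) : ℕ → (F → F)
  | 0 => Y
  | k + 1 => derVF X (DX X Y k)

/-- `applyVF [X₁,…,X_k] Z = X₁·(X₂·(⋯(X_k·Z)))`. -/
def applyVF : List (F → F) → (F → F) → (F → F)
  | [], Z => Z
  | Y :: rest, Z => derVF Y (applyVF rest Z)

/-- `nestedLie [X₁,…,X_k] Z = [X₁,[X₂,[…,[X_k, Z]…]]]`. -/
def nestedLie : List (F → F) → (F → F) → (F → F)
  | [], Z => Z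
  | Y :: rest, Z => lieVF Y (nestedLie rest Z)

/-- Selector for elements of `{X, JX}`: `pickVF X JX true = X`, `pickVF X JX false = JX`. -/
def pickVF (X Y : F → F) (b : Bool) : F → F := if b then X else Y

/-- `X` commutes at order `k` at `p`: all iterated Lie brackets of length `l` with
`2 ≤ l ≤ k` of elements of `{X, JX}` vanish at `p`. -/
def CommutesAtOrder (J : F → F →L[ℝ] F) (X : F → F) (k : ℕ) (p : F) : Prop :=
  ∀ m : ℕ, 1 ≤ m → m + 1 ≤ k → ∀ b : Fin m → Bool, ∀ c : Bool,
    nestedLie (List.ofFn fun i => pickVF X (Jvf J X) (b i))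
      (pickVF X (Jvf J X) c) p = 0


/-- A vector field lies in `T^J M` (with `M = {φ = 0}` inside `U`). -/
def InTJM (J : F → F →L[ℝ] F) (φ : F → ℝ) (U : Set F) (X : F → F) : Prop :=
  ∀ q ∈ U, φ q = 0 → fderiv ℝ φ q (X q) = 0 ∧ fderiv ℝ φ q (J q (X q)) = 0


/-- The polar Levi form
`𝓛̂_φ(X,Y) = dφ(J[X,JY] + J[Y,JX]) + i·dφ(J[X,Y] + J[JX,JY])`. -/
def levihat (J : F → F →L[ℝ] F) (φ : F → ℝ) (X Y : F → F) (q : F) : ℂ :=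
  ((fderiv ℝ φ q (J q (lieVF X (Jvf J Y) q + lieVF Y (Jvf J X) q)) : ℝ) : ℂ) +
  Complex.I * ((fderiv ℝ φ q (J q (lieVF X Y q + lieVF (Jvf J X) (Jvf J Y) q)) : ℝ) : ℂ)

/-- The inverse of the binomial coefficient `(α₀ + α₁)! / (α₀! α₁!)`. -/
def binomWeight (α : Fin 2 →₀ ℕ) : ℝ := (((α 0 + α 1).choose (α 0) : ℕ) : ℝ)⁻¹

lemma choose_cast_pos (α : Fin 2 →₀ ℕ) : (0 : ℝ) < ((α 0 + α 1).choose (α 0) : ℕ) := by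
  exact_mod_cast Nat.choose_pos (Nat.le_add_right _ _)

lemma binomWeight_pos (α : Fin 2 →₀ ℕ) : 0 < binomWeight α := inv_pos.2 (choose_cast_pos α)

lemma binomWeight_zero : binomWeight 0 = 1 := by simp [binomWeight]

lemma binomWeight_add_le (α β : Fin 2 →₀ ℕ) :
    binomWeight (α + β) ≤ binomWeight α * binomWeight β := by
  unfold binomWeight
  rw [← mul_inv]
  apply inv_anti₀ (mul_pos (choose_cast_pos α) (choose_cast_pos β))
  norm_cast
  have h := Nat.add_choose_eq (α 0 + α 1) (β 0 + β 1) (α 0 + β 0)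
  have h2 := Finset.single_le_sum
    (f := fun ij : ℕ × ℕ => (α 0 + α 1).choose ij.1 * (β 0 + β 1).choose ij.2)
    (fun _ _ => Nat.zero_le _)
    (Finset.HasAntidiagonal.mem_antidiagonal.2 (rfl : (α 0, β 0).1 + (α 0, β 0).2 = α 0 + β 0))
  rw [← h] at h2
  simp only [Finsupp.add_apply]
  convert! h2 using 2
  ring

/-- The first coordinate multi-index. -/
def idx0 : Fin 2 →₀ ℕ := Finsupp.single 0 1

/-- The second coordinate multi-index. -/
def idx1 : Fin 2 →₀ ℕ := Finsupp.single 1 1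

@[simp] lemma add_idx0_zero (β : Fin 2 →₀ ℕ) : (β + idx0) 0 = β 0 + 1 := by simp [idx0]
@[simp] lemma add_idx0_one (β : Fin 2 →₀ ℕ) : (β + idx0) 1 = β 1 := by simp [idx0]
@[simp] lemma add_idx1_zero (β : Fin 2 →₀ ℕ) : (β + idx1) 0 = β 0 := by simp [idx1]
@[simp] lemma add_idx1_one (β : Fin 2 →₀ ℕ) : (β + idx1) 1 = β 1 + 1 := by simp [idx1]

lemma binomWeight_add_idx0 (β : Fin 2 →₀ ℕ) :
    binomWeight (β + idx0) = binomWeight β * ((β 0 + 1) / (β 0 + β 1 + 1)) := by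
  have h := Nat.add_one_mul_choose_eq (β 0 + β 1) (β 0)
  have h1 := choose_cast_pos β
  have h2 := choose_cast_pos (β + idx0)
  have h' : ((β 0 : ℝ) + β 1 + 1) * ((β 0 + β 1).choose (β 0) : ℕ)
      = (((β + idx0) 0 + (β + idx0) 1).choose ((β + idx0) 0) : ℕ) * ((β 0 : ℝ) + 1) := by
    simp only [add_idx0_zero, add_idx0_one]
    rw [show β 0 + 1 + β 1 = β 0 + β 1 + 1 by ring]
    exact_mod_cast h
  unfold binomWeight
  field_simp
  linarith

lemma binomWeight_add_idx1 (β : Fin 2 →₀ ℕ) :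
    binomWeight (β + idx1) = binomWeight β * ((β 1 + 1) / (β 0 + β 1 + 1)) := by
  have h := Nat.add_one_mul_choose_eq (β 0 + β 1) (β 1)
  have e1 : (β 0 + β 1).choose (β 1) = (β 0 + β 1).choose (β 0) := Nat.choose_symm_add.symm
  have e2 : (β 0 + β 1 + 1).choose (β 1 + 1) = (β 0 + (β 1 + 1)).choose (β 0) :=
    (Nat.choose_symm_add (a := β 0) (b := β 1 + 1)).symm
  have h1 := choose_cast_pos β
  have h2 := choose_cast_pos (β + idx1)
  have h' : ((β 0 : ℝ) + β 1 + 1) * ((β 0 + β 1).choose (β 0) : ℕ)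
      = (((β + idx1) 0 + (β + idx1) 1).choose ((β + idx1) 0) : ℕ) * ((β 1 : ℝ) + 1) := by
    simp only [add_idx1_zero, add_idx1_one]
    rw [e1, e2] at h
    exact_mod_cast h
  unfold binomWeight
  field_simp
  linarith

lemma abs_monomial_le (x y : ℝ) (h : |x| + |y| ≤ 1) (α : Fin 2 →₀ ℕ) :
    |x ^ α 0 * y ^ α 1| ≤ binomWeight α := by
  unfold binomWeight
  rw [abs_mul, abs_pow, abs_pow, ← one_div, le_div_iff₀ (choose_cast_pos α)]
  have h1 := add_pow |x| |y| (α 0 + α 1)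
  have h2 := Finset.single_le_sum
    (f := fun m => |x| ^ m * |y| ^ (α 0 + α 1 - m) * ((α 0 + α 1).choose m : ℝ))
    (s := Finset.range (α 0 + α 1 + 1)) (fun _ _ => by positivity)
    (Finset.mem_range.2 (by omega : α 0 < α 0 + α 1 + 1))
  rw [← h1] at h2
  simp only [Nat.add_sub_cancel_left] at h2
  exact h2.trans (pow_le_one₀ (by positivity) h)

/-- Summability of a family of coefficients against `binomWeight`. -/
def WSummable (f : MvPowerSeries (Fin 2) ℝ) : Prop :=
  Summable fun α => |MvPowerSeries.coeff α f| * binomWeight α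

/-- The power series with given coefficients. -/
def seriesOf (c : (Fin 2 →₀ ℕ) → ℝ) : MvPowerSeries (Fin 2) ℝ := c

lemma coeff_seriesOf (c : (Fin 2 →₀ ℕ) → ℝ) (α : Fin 2 →₀ ℕ) :
    MvPowerSeries.coeff α (seriesOf c) = c α := rfl

lemma wsummable_mul {f g : MvPowerSeries (Fin 2) ℝ} (hf : WSummable f) (hg : WSummable g) :
    WSummable (f * g) ∧ ∑' α, |MvPowerSeries.coeff α (f * g)| * binomWeight α ≤
      (∑' α, |MvPowerSeries.coeff α f| * binomWeight α) *
        ∑' α, |MvPowerSeries.coeff α g| * binomWeight α := by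
  unfold WSummable at *
  have hle : ∀ α, |MvPowerSeries.coeff α (f * g)| * binomWeight α ≤
      ∑ kl ∈ Finset.HasAntidiagonal.antidiagonal α,
      (|MvPowerSeries.coeff kl.1 f| * binomWeight kl.1) *
        (|MvPowerSeries.coeff kl.2 g| * binomWeight kl.2) := by
    intro α
    rw [MvPowerSeries.coeff_mul]
    refine (mul_le_mul_of_nonneg_right (Finset.abs_sum_le_sum_abs _ _)
      (binomWeight_pos α).le).trans ?_
    rw [Finset.sum_mul]
    refine Finset.sum_le_sum fun p hp => ?_
    rw [← Finset.HasAntidiagonal.mem_antidiagonal.1 hp, abs_mul]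
    refine (mul_le_mul_of_nonneg_left (binomWeight_add_le p.1 p.2) (by positivity)).trans_eq ?_
    ring
  generalize hF : (fun α => |MvPowerSeries.coeff α f| * binomWeight α) = F at hf
  generalize hG : (fun α => |MvPowerSeries.coeff α g| * binomWeight α) = G at hg
  have hF' : ∀ α, |MvPowerSeries.coeff α f| * binomWeight α = F α := fun α => congrFun hF α
  have hG' : ∀ α, |MvPowerSeries.coeff α g| * binomWeight α = G α := fun α => congrFun hG α
  simp only [hF', hG'] at hle ⊢
  have hF0 : 0 ≤ F := fun α => by
    rw [← hF']; exact mul_nonneg (abs_nonneg _) (binomWeight_pos _).le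
  have hG0 : 0 ≤ G := fun α => by
    rw [← hG']; exact mul_nonneg (abs_nonneg _) (binomWeight_pos _).le
  have hfg := hf.mul_of_nonneg hg hF0 hG0
  have hs := summable_sum_mul_antidiagonal_of_summable_mul hfg
  have hsum := Summable.of_nonneg_of_le
    (fun _ => mul_nonneg (abs_nonneg _) (binomWeight_pos _).le) hle hs
  refine ⟨hsum, ?_⟩
  rw [hf.tsum_mul_tsum_eq_tsum_sum_antidiagonal hg hfg]
  exact Summable.tsum_le_tsum hle hsum hs

/-- Power series in two variables whose coefficients are summable against `binomWeight`. -/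
def ckSub : Subalgebra ℝ (MvPowerSeries (Fin 2) ℝ) where
  carrier := {f | WSummable f}
  mul_mem' hf hg := (wsummable_mul hf hg).1
  add_mem' {f g} hf hg := by
    refine Summable.of_nonneg_of_le
      (fun _ => mul_nonneg (abs_nonneg _) (binomWeight_pos _).le) (fun α => ?_) (Summable.add hf hg)
    rw [← add_mul, map_add]
    exact mul_le_mul_of_nonneg_right (abs_add_le _ _) (binomWeight_pos α).le
  algebraMap_mem' r := by
    refine summable_of_ne_finset_zero (s := {0}) fun α hα => ?_
    classical
    rw [MvPowerSeries.algebraMap_apply, MvPowerSeries.coeff_C, if_neg (by simpa using hα)]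
    simp

/-- The Banach algebra of weighted-summable power series in two variables. -/
abbrev CK : Type := ckSub

/-- The coefficients of an element of `CK`. -/
def CK.cf (a : CK) (α : Fin 2 →₀ ℕ) : ℝ := MvPowerSeries.coeff α a.1

lemma CK.wsummable (a : CK) : Summable fun α => |a.cf α| * binomWeight α := a.2

lemma CK.cf_injective {a b : CK} (h : ∀ α, a.cf α = b.cf α) : a = b :=
  Subtype.ext (MvPowerSeries.ext h)

lemma CK.cf_mul (a b : CK) (α : Fin 2 →₀ ℕ) : (a * b).cf α =
    ∑ p ∈ Finset.HasAntidiagonal.antidiagonal α, a.cf p.1 * b.cf p.2 :=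
  MvPowerSeries.coeff_mul α a.1 b.1

lemma CK.cf_one_zero : (1 : CK).cf 0 = 1 := MvPowerSeries.coeff_zero_one

lemma CK.cf_one_of_ne {α : Fin 2 →₀ ℕ} (h : α ≠ 0) : (1 : CK).cf α = 0 := by
  classical
  exact (MvPowerSeries.coeff_one (R := ℝ) α).trans (if_neg h)

/-- Weighted coefficients, as an element of `ℓ¹`. -/
def CK.toLp : CK →ₗ[ℝ] lp (fun _ : Fin 2 →₀ ℕ => ℝ) 1 where
  toFun a := ⟨fun α => a.cf α * binomWeight α, by
    apply memℓp_gen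
    simpa [abs_mul, abs_of_pos (binomWeight_pos _)] using a.wsummable⟩
  map_add' a b := by ext α; exact add_mul (a.cf α) (b.cf α) _
  map_smul' r a := by ext α; exact mul_assoc r (a.cf α) _

lemma CK.toLp_apply (a : CK) (α : Fin 2 →₀ ℕ) : CK.toLp a α = a.cf α * binomWeight α := rfl

lemma CK.toLp_injective : Function.Injective CK.toLp := by
  intro a b h
  refine CK.cf_injective fun α => ?_
  have := congrArg (fun c : lp (fun _ : Fin 2 →₀ ℕ => ℝ) 1 => c α) h
  simp only [CK.toLp_apply] at this
  exact mul_right_cancel₀ (binomWeight_pos α).ne' this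

instance : NormedAddCommGroup CK :=
  NormedAddCommGroup.induced CK (lp (fun _ : Fin 2 →₀ ℕ => ℝ) 1) CK.toLp CK.toLp_injective

lemma CK.norm_toLp (a : CK) : ‖CK.toLp a‖ = ‖a‖ := rfl

lemma CK.norm_eq (a : CK) : ‖a‖ = ∑' α, |a.cf α| * binomWeight α := by
  rw [← CK.norm_toLp, lp.norm_eq_tsum_rpow (by simp)]
  simp [CK.toLp_apply, abs_of_pos (binomWeight_pos _)]

instance : NormedCommRing CK where
  dist_eq := dist_eq_norm_neg_add
  norm_mul_le a b := by
    simp only [CK.norm_eq]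
    exact (wsummable_mul a.wsummable b.wsummable).2
  mul_comm := mul_comm

instance : NormedAlgebra ℝ CK where
  norm_smul_le r a := by
    rw [← CK.norm_toLp, map_smul, norm_smul, CK.norm_toLp]

instance : NormOneClass CK where
  norm_one := by
    rw [CK.norm_eq, tsum_eq_single 0]
    · simp [CK.cf_one_zero, binomWeight_zero]
    · intro α hα
      simp [CK.cf_one_of_ne hα]

instance : CompleteSpace CK := by
  have hiso : Isometry CK.toLp := AddMonoidHomClass.isometry_of_norm CK.toLp CK.norm_toLp
  have hsurj : Function.Surjective CK.toLp := by
    intro b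
    have hb : Summable fun α => |b α| := by
      simpa using (memℓp_gen_iff (p := 1) (by simp)).1 b.2
    refine ⟨⟨seriesOf fun α => b α / binomWeight α, ?_⟩, ?_⟩
    · refine hb.congr fun α => ?_
      rw [coeff_seriesOf, abs_div, abs_of_pos (binomWeight_pos α),
        div_mul_cancel₀ _ (binomWeight_pos α).ne']
    · ext α
      exact div_mul_cancel₀ _ (binomWeight_pos α).ne'
  exact (completeSpace_congr (e := Equiv.ofBijective _ ⟨CK.toLp_injective, hsurj⟩)
    hiso.isUniformEmbedding).2 inferInstance

lemma wsummable_extend {s t : (Fin 2 →₀ ℕ) → (Fin 2 →₀ ℕ)} {κ : (Fin 2 →₀ ℕ) → ℝ}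
    (hs : Function.Injective s) (ht : Function.Injective t)
    (hκ : ∀ β, |κ β| * binomWeight (s β) ≤ binomWeight (t β)) (a : CK) :
    WSummable (seriesOf (Function.extend s (fun β => κ β * a.cf (t β)) 0)) ∧
    ∑' α, |Function.extend s (fun β => κ β * a.cf (t β)) 0 α| * binomWeight α ≤ ‖a‖ := by
  have e : (fun α => |Function.extend s (fun β => κ β * a.cf (t β)) 0 α| * binomWeight α)
      = Function.extend s (fun β => |κ β * a.cf (t β)| * binomWeight (s β)) 0 := by
    funext α
    by_cases h : ∃ β, s β = α
    · obtain ⟨β, rfl⟩ := h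
      simp [hs.extend_apply]
    · simp [Function.extend_apply' _ _ _ h]
  have h1 : Summable fun β => |a.cf (t β)| * binomWeight (t β) :=
    Summable.comp_injective a.wsummable ht
  have hle : ∀ β, |κ β * a.cf (t β)| * binomWeight (s β) ≤ |a.cf (t β)| * binomWeight (t β) := by
    intro β
    rw [abs_mul, mul_comm |κ β|, mul_assoc]
    exact mul_le_mul_of_nonneg_left (hκ β) (abs_nonneg _)
  have h2 : Summable fun β => |κ β * a.cf (t β)| * binomWeight (s β) :=
    Summable.of_nonneg_of_le (fun _ => mul_nonneg (abs_nonneg _) (binomWeight_pos _).le) hle h1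
  constructor
  · change Summable fun α => |Function.extend s (fun β => κ β * a.cf (t β)) 0 α| * binomWeight α
    rw [e]
    exact (summable_extend_zero hs).2 h2
  · rw [e, tsum_extend_zero hs, CK.norm_eq]
    refine (Summable.tsum_le_tsum hle h2 h1).trans ?_
    exact h1.tsum_le_tsum_of_inj t ht
      (fun _ _ => mul_nonneg (abs_nonneg _) (binomWeight_pos _).le) (fun _ => le_rfl) a.wsummable

/-- The operator moving the coefficient at `t β`, multiplied by `κ β`, to `s β`. -/
def CK.shift (s t : (Fin 2 →₀ ℕ) → (Fin 2 →₀ ℕ)) (κ : (Fin 2 →₀ ℕ) → ℝ)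
    (hs : Function.Injective s) (ht : Function.Injective t)
    (hκ : ∀ β, |κ β| * binomWeight (s β) ≤ binomWeight (t β)) : CK →L[ℝ] CK :=
  LinearMap.mkContinuous
    { toFun := fun a => ⟨seriesOf (Function.extend s (fun β => κ β * a.cf (t β)) 0),
        (wsummable_extend hs ht hκ a).1⟩
      map_add' := by
        intro a b
        refine CK.cf_injective fun α => ?_
        change Function.extend s (fun β => κ β * (a.cf (t β) + b.cf (t β))) 0 α =
          Function.extend s (fun β => κ β * a.cf (t β)) 0 α +
          Function.extend s (fun β => κ β * b.cf (t β)) 0 α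
        by_cases h : ∃ β, s β = α
        · obtain ⟨β, rfl⟩ := h
          simp [hs.extend_apply, mul_add]
        · simp [Function.extend_apply' _ _ _ h]
      map_smul' := by
        intro r a
        refine CK.cf_injective fun α => ?_
        change Function.extend s (fun β => κ β * (r * a.cf (t β))) 0 α =
          r * Function.extend s (fun β => κ β * a.cf (t β)) 0 α
        by_cases h : ∃ β, s β = α
        · obtain ⟨β, rfl⟩ := h
          simp [hs.extend_apply, mul_left_comm]
        · simp [Function.extend_apply' _ _ _ h] } 1 (by
    intro a
    rw [one_mul, CK.norm_eq]
    exact (wsummable_extend hs ht hκ a).2)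

/-- Evaluation of a power series at `z`. -/
def CK.ev (z : ℝ × ℝ) (a : CK) : ℝ := ∑' α, a.cf α * (z.1 ^ α 0 * z.2 ^ α 1)

lemma CK.ev_shift {s t : (Fin 2 →₀ ℕ) → (Fin 2 →₀ ℕ)} {κ : (Fin 2 →₀ ℕ) → ℝ}
    (hs : Function.Injective s) (ht : Function.Injective t)
    (hκ : ∀ β, |κ β| * binomWeight (s β) ≤ binomWeight (t β)) (z : ℝ × ℝ) (a : CK) :
    CK.ev z (CK.shift s t κ hs ht hκ a) =
      ∑' β, κ β * a.cf (t β) * (z.1 ^ s β 0 * z.2 ^ s β 1) := by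
  rw [← tsum_extend_zero hs]
  refine tsum_congr fun α => ?_
  change Function.extend s (fun β => κ β * a.cf (t β)) 0 α * _ = _
  by_cases h : ∃ β, s β = α
  · obtain ⟨β, rfl⟩ := h
    simp [hs.extend_apply]
  · simp [Function.extend_apply' _ _ _ h]

lemma CK.norm_term_le {z : ℝ × ℝ} (hz : |z.1| + |z.2| ≤ 1) (a : CK) (α : Fin 2 →₀ ℕ) :
    ‖a.cf α * (z.1 ^ α 0 * z.2 ^ α 1)‖ ≤ |a.cf α| * binomWeight α := by
  rw [norm_mul]
  exact mul_le_mul_of_nonneg_left (abs_monomial_le _ _ hz α) (abs_nonneg _)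

lemma CK.summable_ev {z : ℝ × ℝ} (hz : |z.1| + |z.2| ≤ 1) (a : CK) :
    Summable fun α => a.cf α * (z.1 ^ α 0 * z.2 ^ α 1) :=
  Summable.of_norm_bounded a.wsummable (CK.norm_term_le hz a)

lemma CK.abs_ev_le {z : ℝ × ℝ} (hz : |z.1| + |z.2| ≤ 1) (a : CK) : |CK.ev z a| ≤ ‖a‖ := by
  rw [CK.norm_eq]
  exact tsum_of_norm_bounded (CK.wsummable a).hasSum (CK.norm_term_le hz a)

lemma CK.ev_mul {z : ℝ × ℝ} (hz : |z.1| + |z.2| ≤ 1) (a b : CK) :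
    CK.ev z (a * b) = CK.ev z a * CK.ev z b := by
  have ha := CK.summable_ev hz a
  have hb := CK.summable_ev hz b
  unfold CK.ev
  rw [ha.tsum_mul_tsum_eq_tsum_sum_antidiagonal hb (summable_mul_of_summable_norm ha.norm hb.norm)]
  refine tsum_congr fun α => ?_
  rw [CK.cf_mul, Finset.sum_mul]
  refine Finset.sum_congr rfl fun p hp => ?_
  rw [← Finset.HasAntidiagonal.mem_antidiagonal.1 hp]
  simp only [Finsupp.add_apply, pow_add]
  ring

/-- Evaluation at a point of the closed `ℓ¹` unit ball, as an algebra homomorphism. -/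
def CK.evHom (z : ℝ × ℝ) (hz : |z.1| + |z.2| ≤ 1) : CK →ₐ[ℝ] ℝ :=
  AlgHom.ofLinearMap
    { toFun := CK.ev z
      map_add' := fun a b => by
        unfold CK.ev
        rw [← (CK.summable_ev hz a).tsum_add (CK.summable_ev hz b)]
        exact tsum_congr fun α => add_mul _ _ _
      map_smul' := fun r a => by
        unfold CK.ev
        rw [RingHom.id_apply, smul_eq_mul, ← tsum_mul_left]
        exact tsum_congr fun α => mul_assoc _ _ _ }
    (by
      change CK.ev z 1 = 1
      unfold CK.ev
      rw [tsum_eq_single 0]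
      · simp [CK.cf_one_zero]
      · intro α hα
        simp [CK.cf_one_of_ne hα])
    (CK.ev_mul hz)

lemma CK.evHom_apply (z : ℝ × ℝ) (hz : |z.1| + |z.2| ≤ 1) (a : CK) :
    CK.evHom z hz a = CK.ev z a := rfl

/-- Restriction to the first coordinate axis. -/
def CK.restrict : CK →L[ℝ] CK :=
  CK.shift id id (fun β => if β 1 = 0 then 1 else 0) Function.injective_id Function.injective_id
    (fun β => by
      have := (binomWeight_pos β).le
      split_ifs <;> simp [this])

/-- Restriction to the first coordinate axis followed by integration in the first variable. -/
def CK.int0 : CK →L[ℝ] CK :=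
  CK.shift (· + idx0) id (fun β => if β 1 = 0 then 1 / ((β 0 : ℝ) + 1) else 0)
    (add_left_injective _) Function.injective_id (fun β => by
      have := (binomWeight_pos β).le
      split_ifs with h
      · rw [abs_of_pos (by positivity), binomWeight_add_idx0, h, id, Nat.cast_zero, add_zero]
        have h0 : (β 0 : ℝ) + 1 ≠ 0 := by positivity
        rw [div_self h0, mul_one]
        refine mul_le_of_le_one_left this ?_
        rw [div_le_one (by positivity)]
        have : (0 : ℝ) ≤ (β 0 : ℝ) := by positivity
        linarith
      · simpa using this)

/-- Integration in the second variable. -/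
def CK.int1 : CK →L[ℝ] CK :=
  CK.shift (· + idx1) id (fun β => 1 / ((β 1 : ℝ) + 1))
    (add_left_injective _) Function.injective_id (fun β => by
      have := (binomWeight_pos β).le
      rw [abs_of_pos (by positivity), binomWeight_add_idx1, id]
      have h1 : 1 / ((β 1 : ℝ) + 1) * (binomWeight β * ((β 1 + 1) / (β 0 + β 1 + 1)))
        = binomWeight β * (1 / ((β 0 : ℝ) + β 1 + 1)) := by
        have : (β 1 : ℝ) + 1 ≠ 0 := by positivity
        field_simp
      rw [h1]
      refine mul_le_of_le_one_right this ?_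
      rw [div_le_one (by positivity)]
      have : (0 : ℝ) ≤ (β 0 : ℝ) + β 1 := by positivity
      linarith)

/-- Integration in the second variable followed by differentiation in the first one. -/
def CK.int1deriv0 : CK →L[ℝ] CK :=
  CK.shift (· + idx1) (· + idx0) (fun β => ((β 0 : ℝ) + 1) / ((β 1 : ℝ) + 1))
    (add_left_injective _) (add_left_injective _) (fun β => by
      rw [abs_of_pos (by positivity), binomWeight_add_idx1, binomWeight_add_idx0]
      apply le_of_eq
      have : (β 1 : ℝ) + 1 ≠ 0 := by positivity
      field_simp)

lemma CK.ev_restrict (x y : ℝ) (a : CK) : CK.ev (x, y) (CK.restrict a) = CK.ev (x, 0) a := by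
  unfold CK.restrict
  rw [CK.ev_shift]
  refine tsum_congr fun β => ?_
  by_cases h : β 1 = 0 <;> simp [h]

lemma CK.ev_int0_eq (x y : ℝ) (a : CK) :
    CK.ev (x, y) (CK.int0 a) = CK.ev (x, 0) (CK.int0 a) := by
  unfold CK.int0
  rw [CK.ev_shift, CK.ev_shift]
  refine tsum_congr fun β => ?_
  by_cases h : β 1 = 0 <;> simp [h]

lemma CK.ev_int0_zero (a : CK) : CK.ev (0, 0) (CK.int0 a) = 0 := by
  unfold CK.int0
  rw [CK.ev_shift]
  simp

lemma CK.ev_int1_zero (x : ℝ) (a : CK) : CK.ev (x, 0) (CK.int1 a) = 0 := by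
  unfold CK.int1
  rw [CK.ev_shift]
  simp

lemma CK.ev_int1deriv0_zero (x : ℝ) (a : CK) : CK.ev (x, 0) (CK.int1deriv0 a) = 0 := by
  unfold CK.int1deriv0
  rw [CK.ev_shift]
  simp

lemma CK.hasDerivAt_int0 {x y : ℝ} (h : |x| + |y| < 1) (a : CK) :
    HasDerivAt (fun s => CK.ev (s, y) (CK.int0 a)) (CK.ev (x, 0) a) x := by
  have hxmem : x ∈ ball (0 : ℝ) 1 := by
    rw [mem_ball_zero_iff, Real.norm_eq_abs]
    linarith [abs_nonneg y]
  have hmem : ∀ s ∈ ball (0 : ℝ) 1, |s| + |(0 : ℝ)| ≤ 1 := fun s hs => by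
    simpa using (mem_ball_zero_iff.1 hs).le
  have e : (fun s => CK.ev (s, y) (CK.int0 a)) = fun s => ∑' β, (if β 1 = 0 then
      1 / ((β 0 : ℝ) + 1) else 0) * a.cf β * s ^ (β 0 + 1) := by
    funext s
    unfold CK.int0
    rw [CK.ev_shift]
    refine tsum_congr fun β => ?_
    by_cases h : β 1 = 0 <;> simp [h]
  rw [e, ← CK.ev_restrict x 0]
  have e2 : CK.ev (x, 0) (CK.restrict a)
      = ∑' β, (if β 1 = 0 then 1 else 0) * a.cf β * x ^ β 0 := by
    unfold CK.restrict
    rw [CK.ev_shift]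
    refine tsum_congr fun β => ?_
    by_cases h : β 1 = 0 <;> simp [h]
  rw [e2]
  refine hasDerivAt_tsum_of_isPreconnected (y₀ := (0 : ℝ))
    (g := (fun (β : Fin 2 →₀ ℕ) (s : ℝ) => (if β 1 = 0 then
      1 / ((β 0 : ℝ) + 1) else 0) * a.cf β * s ^ (β 0 + 1)))
    (g' := (fun (β : Fin 2 →₀ ℕ) (s : ℝ) => (if β 1 = 0 then 1 else 0) * a.cf β * s ^ β 0))
    a.wsummable isOpen_ball
    (convex_ball (0 : ℝ) 1).isPreconnected (fun β s _ => ?_) (fun β s hs => ?_)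
    (mem_ball_self one_pos) ?_ hxmem
  · have hd := ((hasDerivAt_id s).pow (β 0 + 1)).const_mul
      ((if β 1 = 0 then 1 / ((β 0 : ℝ) + 1) else 0) * a.cf β)
    convert! hd using 1
    have : (β 0 : ℝ) + 1 ≠ 0 := by positivity
    split_ifs
    · simp; field_simp
    · simp
  · by_cases h : β 1 = 0
    · have := CK.norm_term_le (z := (s, 0)) (hmem s hs) a β
      simpa [h] using this
    · simp [h, (binomWeight_pos β).le, mul_nonneg]
  · simp

lemma CK.hasDerivAt_int1 {x y : ℝ} (h : |x| + |y| < 1) (a : CK) :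
    HasDerivAt (fun s => CK.ev (x, s) (CK.int1 a)) (CK.ev (x, y) a) y := by
  have hpos : 0 < 1 - |x| := by linarith [abs_nonneg y]
  have hymem : y ∈ ball (0 : ℝ) (1 - |x|) := by
    rw [mem_ball_zero_iff, Real.norm_eq_abs]
    linarith
  have hmem : ∀ s ∈ ball (0 : ℝ) (1 - |x|), |x| + |s| ≤ 1 := fun s hs => by
    have : |s| < 1 - |x| := by simpa using hs
    linarith
  have e : (fun s => CK.ev (x, s) (CK.int1 a)) = fun s => ∑' β,
      1 / ((β 1 : ℝ) + 1) * a.cf β * (x ^ β 0 * s ^ (β 1 + 1)) := by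
    funext s
    unfold CK.int1
    rw [CK.ev_shift]
    simp
  rw [e]
  refine hasDerivAt_tsum_of_isPreconnected (y₀ := (0 : ℝ))
    (g := (fun (β : Fin 2 →₀ ℕ) (s : ℝ) =>
      1 / ((β 1 : ℝ) + 1) * a.cf β * (x ^ β 0 * s ^ (β 1 + 1))))
    (g' := (fun (β : Fin 2 →₀ ℕ) (s : ℝ) => a.cf β * (x ^ β 0 * s ^ β 1)))
    a.wsummable isOpen_ball
    (convex_ball (0 : ℝ) (1 - |x|)).isPreconnected (fun β s _ => ?_) (fun β s hs => ?_)
    (mem_ball_self hpos) ?_ hymem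
  · have hd := (((hasDerivAt_id s).pow (β 1 + 1)).const_mul (x ^ β 0)).const_mul
      (1 / ((β 1 : ℝ) + 1) * a.cf β)
    convert! hd using 1
    have : (β 1 : ℝ) + 1 ≠ 0 := by positivity
    simp; field_simp
  · exact CK.norm_term_le (z := (x, s)) (hmem s hs) a β
  · simp

lemma CK.hasDerivAt_int1_fst {x y : ℝ} (h : |x| + |y| < 1) (a : CK) :
    HasDerivAt (fun s => CK.ev (s, y) (CK.int1 a)) (CK.ev (x, y) (CK.int1deriv0 a)) x := by
  have hpos : 0 < 1 - |y| := by linarith [abs_nonneg x]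
  have hxmem : x ∈ ball (0 : ℝ) (1 - |y|) := by
    rw [mem_ball_zero_iff, Real.norm_eq_abs]
    linarith
  have hmem : ∀ s ∈ ball (0 : ℝ) (1 - |y|), |s| + |y| ≤ 1 := fun s hs => by
    have : |s| < 1 - |y| := by simpa using hs
    linarith
  have e : (fun s => CK.ev (s, y) (CK.int1 a)) = fun s => ∑' β,
      1 / ((β 1 : ℝ) + 1) * a.cf β * (s ^ β 0 * y ^ (β 1 + 1)) := by
    funext s
    unfold CK.int1
    rw [CK.ev_shift]
    simp
  have hinj : Function.Injective (fun γ : Fin 2 →₀ ℕ => γ + idx0) := add_left_injective _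
  have hrange : ∀ β : Fin 2 →₀ ℕ, β ∉ Set.range (fun γ : Fin 2 →₀ ℕ => γ + idx0) → β 0 = 0 := by
    intro β hβ
    by_contra h0
    refine hβ ⟨β - idx0, ?_⟩
    apply tsub_add_cancel_of_le
    intro i
    fin_cases i
    · simp [idx0]; omega
    · simp [idx0]
  have e2 : CK.ev (x, y) (CK.int1deriv0 a) = ∑' β,
      1 / ((β 1 : ℝ) + 1) * a.cf β * ((β 0 * x ^ (β 0 - 1)) * y ^ (β 1 + 1)) := by
    unfold CK.int1deriv0
    rw [CK.ev_shift]
    refine Eq.trans (tsum_congr fun γ => ?_) (hinj.tsum_eq ?_)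
    · simp
      ring
    · intro β hβ
      by_contra hc
      apply hβ
      simp [hrange β hc]
  rw [e, e2]
  refine hasDerivAt_tsum_of_isPreconnected (y₀ := (0 : ℝ))
    (g := (fun (β : Fin 2 →₀ ℕ) (s : ℝ) =>
      1 / ((β 1 : ℝ) + 1) * a.cf β * (s ^ β 0 * y ^ (β 1 + 1))))
    (g' := (fun (β : Fin 2 →₀ ℕ) (s : ℝ) => 1 / ((β 1 : ℝ) + 1) * a.cf β *
      ((β 0 * s ^ (β 0 - 1)) * y ^ (β 1 + 1))))
    a.wsummable isOpen_ball
    (convex_ball (0 : ℝ) (1 - |y|)).isPreconnected (fun β s _ => ?_) (fun β s hs => ?_)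
    (mem_ball_self hpos) ?_ hxmem
  · have hd := ((hasDerivAt_pow (β 0) s).mul_const (y ^ (β 1 + 1))).const_mul
      (1 / ((β 1 : ℝ) + 1) * a.cf β)
    exact hd
  · by_cases hβ : β ∈ Set.range (fun γ : Fin 2 →₀ ℕ => γ + idx0)
    · obtain ⟨γ, rfl⟩ := hβ
      have h1 := abs_monomial_le s y (hmem s hs) (γ + idx1)
      simp only [add_idx1_zero, add_idx1_one, add_idx0_zero, add_idx0_one] at h1 ⊢
      have h2 : binomWeight (γ + idx0) = ((γ 0 : ℝ) + 1) / ((γ 1 : ℝ) + 1) *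
          binomWeight (γ + idx1) := by
        rw [binomWeight_add_idx1, binomWeight_add_idx0]
        have : (γ 1 : ℝ) + 1 ≠ 0 := by positivity
        field_simp
      rw [h2]
      have h3 : 1 / ((γ 1 : ℝ) + 1) * a.cf (γ + idx0) *
          (((γ 0 + 1 : ℕ) : ℝ) * s ^ (γ 0 + 1 - 1) * y ^ (γ 1 + 1)) =
          a.cf (γ + idx0) * (((γ 0 : ℝ) + 1) / ((γ 1 : ℝ) + 1) * (s ^ γ 0 * y ^ (γ 1 + 1))) := by
        push_cast
        simp
        ring
      rw [h3, norm_mul, norm_mul, Real.norm_eq_abs, Real.norm_eq_abs, Real.norm_eq_abs,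
        abs_of_pos (by positivity : 0 < ((γ 0 : ℝ) + 1) / ((γ 1 : ℝ) + 1))]
      gcongr
    · simp [hrange β hβ, (binomWeight_pos β).le, mul_nonneg]
  · have := CK.summable_ev (z := (0, y)) (by simpa using (by linarith [abs_nonneg x] : |y| ≤ 1))
      (CK.int1 a)
    have hs := (add_left_injective (idx1 : Fin 2 →₀ ℕ))
    have h2 := this.comp_injective hs
    refine h2.congr fun β => ?_
    have : (CK.int1 a).cf (β + idx1) = 1 / ((β 1 : ℝ) + 1) * a.cf β := by
      change Function.extend (· + idx1) (fun β => 1 / ((β 1 : ℝ) + 1) * a.cf (id β)) 0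
        (β + idx1) = _
      exact hs.extend_apply _ _ _
    simp [this]

/-- The monomial of bidegree `(k, m - k)` as a multilinear map. -/
def monomialMultilinear (k m : ℕ) : ContinuousMultilinearMap ℝ (fun _ : Fin m => ℝ × ℝ) ℝ :=
  (ContinuousMultilinearMap.mkPiAlgebra ℝ (Fin m) ℝ).compContinuousLinearMap
    (fun j => if j.1 < k then ContinuousLinearMap.fst ℝ ℝ ℝ else ContinuousLinearMap.snd ℝ ℝ ℝ)

lemma monomialMultilinear_apply (k l : ℕ) (z : ℝ × ℝ) :
    monomialMultilinear k (k + l) (fun _ => z) = z.1 ^ k * z.2 ^ l := by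
  simp only [monomialMultilinear, ContinuousMultilinearMap.compContinuousLinearMap_apply,
    ContinuousMultilinearMap.mkPiAlgebra_apply]
  rw [Fin.prod_univ_add]
  simp

lemma norm_monomialMultilinear_le (k m : ℕ) : ‖monomialMultilinear k m‖ ≤ 1 := by
  refine ContinuousMultilinearMap.opNorm_le_bound zero_le_one fun v => ?_
  simp only [monomialMultilinear, ContinuousMultilinearMap.compContinuousLinearMap_apply,
    ContinuousMultilinearMap.mkPiAlgebra_apply, norm_prod, one_mul]
  refine Finset.prod_le_prod (fun _ _ => norm_nonneg _) fun j _ => ?_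
  split_ifs
  · exact norm_fst_le (v j)
  · exact norm_snd_le (v j)

/-- Multi-indices in two variables as pairs. -/
def idxEquiv : ℕ × ℕ ≃ (Fin 2 →₀ ℕ) :=
  (finTwoArrowEquiv ℕ).symm.trans Finsupp.equivFunOnFinite.symm

lemma binomWeight_ge (α : Fin 2 →₀ ℕ) : (1 / 2 : ℝ) ^ (α 0 + α 1) ≤ binomWeight α := by
  unfold binomWeight
  rw [one_div, inv_pow]
  apply inv_anti₀ (choose_cast_pos α)
  exact_mod_cast Nat.choose_le_two_pow _ _

lemma CK.hasFPowerSeriesOnBall_ev (a : CK) :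
    HasFPowerSeriesOnBall (fun z => CK.ev z a)
      (fun m => ∑ q ∈ Finset.HasAntidiagonal.antidiagonal m,
        a.cf (idxEquiv q) • monomialMultilinear q.1 m) 0
      ((1 / 2 : NNReal) : ENNReal) := by
  have hsum : Summable fun q : ℕ × ℕ => |a.cf (idxEquiv q)| * (1 / 2 : ℝ) ^ (q.1 + q.2) := by
    refine Summable.of_nonneg_of_le (fun _ => by positivity) (fun q => ?_)
      (idxEquiv.summable_iff.2 a.wsummable)
    exact mul_le_mul_of_nonneg_left (binomWeight_ge (idxEquiv q)) (abs_nonneg _)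
  refine ⟨?_, by norm_num, ?_⟩
  · apply FormalMultilinearSeries.le_radius_of_summable
    have h1 := (Finset.HasAntidiagonal.sigmaAntidiagonalEquivProd (A := ℕ)).summable_iff.2 hsum
    have h2 := h1.sigma' (fun m => Summable.of_finite)
    refine Summable.of_nonneg_of_le (fun _ => by positivity) (fun m => ?_) h2
    rw [tsum_fintype]
    refine (mul_le_mul_of_nonneg_right (norm_sum_le _ _) (by positivity)).trans ?_
    rw [Finset.sum_mul, ← Finset.sum_coe_sort]
    refine Finset.sum_le_sum fun q _ => ?_
    have hq : q.1.1 + q.1.2 = m := Finset.HasAntidiagonal.mem_antidiagonal.1 q.2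
    rw [norm_smul]
    change |a.cf (idxEquiv q)| * _ * _ ≤ |a.cf (idxEquiv q)| * (1 / 2 : ℝ) ^ (q.1.1 + q.1.2)
    rw [hq]
    have := norm_monomialMultilinear_le q.1.1 m
    refine mul_le_mul (mul_le_of_le_one_right (abs_nonneg _) this) ?_ (by positivity)
      (abs_nonneg _)
    simp
  · intro z hz
    have hz' : ‖z‖ < 1 / 2 := by
      have := hz
      simp only [Metric.mem_eball, edist_zero_right] at this
      rw [← ofReal_norm, ENNReal.ofReal_lt_coe_iff (by positivity)] at this
      simpa using this
    have hz1 : |z.1| ≤ ‖z‖ := norm_fst_le z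
    have hz2 : |z.2| ≤ ‖z‖ := norm_snd_le z
    have hs := (CK.summable_ev (z := z) (by linarith) a).hasSum
    have h1 := (Finset.HasAntidiagonal.sigmaAntidiagonalEquivProd (A := ℕ)).hasSum_iff.2
      (idxEquiv.hasSum_iff.2 hs)
    have h2 := h1.sigma (fun m => hasSum_fintype _)
    rw [zero_add]
    convert! h2 using 1
    funext m
    rw [_root_.sum_apply, ← Finset.sum_coe_sort]
    refine Finset.sum_congr rfl fun q _ => ?_
    obtain ⟨⟨k, l⟩, hq⟩ := q
    obtain rfl : k + l = m := Finset.HasAntidiagonal.mem_antidiagonal.1 hq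
    rw [_root_.smul_apply, monomialMultilinear_apply]
    rfl

lemma CK.analyticOnNhd_ev (a : CK) :
    AnalyticOnNhd ℝ (fun z => CK.ev z a) (ball (0 : ℝ × ℝ) (1 / 2)) := by
  intro z hz
  apply (CK.hasFPowerSeriesOnBall_ev a).analyticAt_of_mem
  rw [Metric.mem_eball, edist_zero_right, ← ofReal_norm,
    ENNReal.ofReal_lt_coe_iff (by positivity)]
  simpa using hz

/-- The power series with the same coefficients as `p`, with variables in an algebra. -/
def algebraSeries (A : Type*) [NormedCommRing A] [NormedAlgebra ℝ A] {d : ℕ}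
    (p : FormalMultilinearSeries ℝ (Fin d → ℝ) ℝ) : FormalMultilinearSeries ℝ (Fin d → A) A :=
  fun m => ∑ i : Fin m → Fin d, p m (fun j => Pi.single (i j) 1) •
    (ContinuousMultilinearMap.mkPiAlgebra ℝ (Fin m) A).compContinuousLinearMap
      (fun j => ContinuousLinearMap.proj (i j))

lemma algebraSeries_apply (A : Type*) [NormedCommRing A] [NormedAlgebra ℝ A] {d : ℕ}
    (p : FormalMultilinearSeries ℝ (Fin d → ℝ) ℝ) (m : ℕ) (v : Fin m → Fin d → A) :
    algebraSeries A p m v = ∑ i : Fin m → Fin d, p m (fun j => Pi.single (i j) 1) •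
      ∏ j, v j (i j) := by
  rw [algebraSeries, _root_.sum_apply]
  rfl

lemma norm_algebraSeries_le (A : Type*) [NormedCommRing A] [NormedAlgebra ℝ A] [NormOneClass A]
    {d : ℕ} (p : FormalMultilinearSeries ℝ (Fin d → ℝ) ℝ) (m : ℕ) :
    ‖algebraSeries A p m‖ ≤ (d : ℝ) ^ m * ‖p m‖ := by
  refine ContinuousMultilinearMap.opNorm_le_bound (by positivity) fun v => ?_
  rw [algebraSeries_apply]
  refine (norm_sum_le _ _).trans ?_
  have h : ∀ i ∈ (Finset.univ : Finset (Fin m → Fin d)),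
      ‖p m (fun j => Pi.single (i j) 1) • ∏ j, v j (i j)‖ ≤ ‖p m‖ * ∏ j, ‖v j‖ := by
    intro i _
    rw [norm_smul]
    refine mul_le_mul ?_ ?_ (norm_nonneg _) (norm_nonneg _)
    · refine ((p m).le_opNorm _).trans (mul_le_of_le_one_right (norm_nonneg _) ?_)
      refine Finset.prod_le_one (fun _ _ => norm_nonneg _) fun j _ => ?_
      rw [Pi.norm_single]
      simp
    · refine (Finset.norm_prod_le _ _).trans ?_
      exact Finset.prod_le_prod (fun _ _ => norm_nonneg _) fun j _ => norm_le_pi_norm (v j) (i j)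
  refine (Finset.sum_le_sum h).trans (le_of_eq ?_)
  simp [mul_assoc]

lemma algHom_algebraSeries {A : Type*} [NormedCommRing A] [NormedAlgebra ℝ A] {d : ℕ}
    (p : FormalMultilinearSeries ℝ (Fin d → ℝ) ℝ) (χ : A →ₐ[ℝ] ℝ) (m : ℕ) (v : Fin d → A) :
    χ (algebraSeries A p m fun _ => v) = p m (fun _ i => χ (v i)) := by
  have h : (fun i => χ (v i)) = ∑ i, χ (v i) • (Pi.single i 1 : Fin d → ℝ) := by
    ext k
    simp [Finset.sum_apply, Pi.single_apply]
  have h2 : p m (fun _ i => χ (v i)) = p m (fun _ => ∑ i, χ (v i) • (Pi.single i 1)) :=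
    congrArg (fun w : Fin d → ℝ => p m fun _ => w) h
  rw [algebraSeries_apply, map_sum, h2, ContinuousMultilinearMap.map_sum]
  refine Finset.sum_congr rfl fun i _ => ?_
  rw [ContinuousMultilinearMap.map_smul_univ, map_smul, map_prod, smul_eq_mul, smul_eq_mul,
    mul_comm]

/-- Real analytic functions of several variables act on tuples of small elements of a
commutative Banach algebra, compatibly with contractive characters. -/
lemma exists_analyticAt_algebra (A : Type*) [NormedCommRing A] [NormedAlgebra ℝ A]
    [NormOneClass A] [CompleteSpace A] {d : ℕ} {f : (Fin d → ℝ) → ℝ} (hf : AnalyticAt ℝ f 0) :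
    ∃ fA : (Fin d → A) → A, AnalyticAt ℝ fA 0 ∧ ∀ᶠ v in nhds 0, ∀ χ : A →ₐ[ℝ] ℝ,
      (∀ a, |χ a| ≤ ‖a‖) → χ (fA v) = f (fun i => χ (v i)) := by
  obtain ⟨p, R, hp⟩ := hf
  obtain ⟨s, hs0, hsR⟩ := ENNReal.lt_iff_exists_nnreal_btwn.1 hp.r_pos
  have hs0' : 0 < s := by exact_mod_cast hs0
  obtain ⟨C, hC, hbound⟩ := p.norm_mul_pow_le_of_lt_radius (hsR.trans_le hp.r_le)
  have hrad : ((s / (d + 1) : NNReal) : ENNReal) ≤ (algebraSeries A p).radius := by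
    refine FormalMultilinearSeries.le_radius_of_bound _ C fun m => ?_
    refine le_trans ?_ (hbound m)
    refine (mul_le_mul_of_nonneg_right (norm_algebraSeries_le A p m) (by positivity)).trans ?_
    rw [mul_right_comm, mul_comm, ← mul_pow]
    refine mul_le_mul_of_nonneg_left (pow_le_pow_left₀ (by positivity) ?_ m) (norm_nonneg _)
    push_cast
    rw [mul_div_assoc', div_le_iff₀ (by positivity)]
    nlinarith [s.2]
  have hpos : 0 < s / (d + 1) := by positivity
  have hq := (algebraSeries A p).hasFPowerSeriesOnBall
    (lt_of_lt_of_le (by exact_mod_cast hpos) hrad)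
  refine ⟨_, hq.analyticAt, ?_⟩
  filter_upwards [ball_mem_nhds (0 : Fin d → A) (NNReal.coe_pos.2 hpos)] with v hv χ hχ
  rw [mem_ball_zero_iff] at hv
  have hv1 : v ∈ eball (0 : Fin d → A) (algebraSeries A p).radius := by
    rw [mem_eball_zero_iff]
    refine lt_of_lt_of_le ?_ hrad
    rw [enorm_eq_nnnorm]
    exact_mod_cast hv
  have hv2 : (fun i => χ (v i)) ∈ eball (0 : Fin d → ℝ) R := by
    rw [mem_eball_zero_iff]
    refine lt_trans ?_ hsR
    rw [enorm_eq_nnnorm]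
    norm_cast
    rw [← NNReal.coe_lt_coe, coe_nnnorm]
    have h1 : ‖fun i => χ (v i)‖ ≤ ‖v‖ := by
      refine (pi_norm_le_iff_of_nonneg (norm_nonneg _)).2 fun i => ?_
      exact (hχ _).trans (norm_le_pi_norm v i)
    have h2 : ((s / (d + 1) : NNReal) : ℝ) ≤ s := by
      push_cast
      exact div_le_self s.2 (by linarith [(Nat.cast_nonneg d : (0 : ℝ) ≤ d)])
    exact (h1.trans_lt hv).trans_le h2
  have h1 := hq.hasSum hv1
  have h2 := hp.hasSum hv2
  rw [zero_add] at h1 h2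
  have hcont : Continuous χ := by
    exact (LinearMap.mkContinuous χ.toLinearMap 1 fun a => by
      rw [one_mul]; exact hχ a).continuous
  have h3 := h1.map χ hcont
  refine h3.unique ?_
  convert! h2 using 1
  funext m
  exact algHom_algebraSeries p χ m v

lemma exists_small_fixedPoint {W : Type*} [NormedAddCommGroup W] [NormedSpace ℝ W]
    [CompleteSpace W] {Ψ : ℝ × W → W} (hΨ : AnalyticAt ℝ Ψ 0) {ε : ℝ} (hε : 0 < ε) :
    ∃ δ > (0 : ℝ), ∃ w : W, ‖w‖ < ε ∧ w = δ • Ψ (δ, w) := by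
  have hΨ' := hΨ.hasStrictFDerivAt
  have hd : HasStrictFDerivAt (fun q : ℝ × W => (q.1, q.2 - q.1 • Ψ q)) _ 0 :=
    (ContinuousLinearMap.fst ℝ ℝ W).hasStrictFDerivAt.prodMk
      ((ContinuousLinearMap.snd ℝ ℝ W).hasStrictFDerivAt.sub
        ((ContinuousLinearMap.fst ℝ ℝ W).hasStrictFDerivAt.smul hΨ'))
  have hmap := hd.map_nhds_eq_of_surj (by
    rw [LinearMap.range_eq_top]
    rintro ⟨a, w⟩
    refine ⟨(a, w + a • Ψ 0), ?_⟩
    simp)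
  have hmem := Filter.image_mem_map (m := fun q : ℝ × W => (q.1, q.2 - q.1 • Ψ q))
    (ball_mem_nhds (0 : ℝ × W) hε)
  rw [hmap] at hmem
  have h0 : ((0 : ℝ × W).1, (0 : ℝ × W).2 - (0 : ℝ × W).1 • Ψ 0) = ((0 : ℝ), (0 : W)) := by simp
  rw [h0] at hmem
  have hc : Filter.Tendsto (fun δ : ℝ => (δ, (0 : W))) (nhdsWithin 0 (Set.Ioi 0))
      (nhds ((0 : ℝ), (0 : W))) :=
    ((Continuous.prodMk_left (0 : W)).tendsto 0).mono_left nhdsWithin_le_nhds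
  obtain ⟨δ, hδ, hδ0⟩ := ((hc.eventually_mem hmem).and self_mem_nhdsWithin).exists
  obtain ⟨⟨δ', w⟩, hq, he⟩ := hδ
  obtain ⟨rfl, hw⟩ : δ' = δ ∧ w - δ' • Ψ (δ', w) = 0 := by simpa using he
  refine ⟨δ', hδ0, w, ?_, sub_eq_zero.1 hw⟩
  have := norm_snd_le ((δ', w) : ℝ × W)
  exact this.trans_lt (by simpa using hq)

lemma CK.exists_solution {d : ℕ} {XA : Fin d → (Fin d → CK) → CK}
    {JA : Fin d → Fin d → (Fin d → CK) → CK} (hX : ∀ i, AnalyticAt ℝ (XA i) 0)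
    (hJ : ∀ i j, AnalyticAt ℝ (JA i j) 0) {ε : ℝ} (hε : 0 < ε) :
    ∃ δ > (0 : ℝ), ∃ c h : Fin d → CK, ‖c‖ < ε ∧ ‖h‖ < ε ∧
      (∀ i, c i = δ • CK.int0 (XA i c)) ∧
      ∀ i, h i = δ • ∑ j, JA i j (fun k => c k + CK.int1 (h k)) *
        (δ • CK.restrict (XA j c) + CK.int1deriv0 (h j)) := by
  let π1 : (ℝ × (Fin d → CK) × (Fin d → CK)) →L[ℝ] (Fin d → CK) :=
    (ContinuousLinearMap.fst ℝ _ _).comp (ContinuousLinearMap.snd ℝ _ _)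
  let π2 : (ℝ × (Fin d → CK) × (Fin d → CK)) →L[ℝ] (Fin d → CK) :=
    (ContinuousLinearMap.snd ℝ _ _).comp (ContinuousLinearMap.snd ℝ _ _)
  let κ : (ℝ × (Fin d → CK) × (Fin d → CK)) →L[ℝ] (Fin d → CK) :=
    π1 + (ContinuousLinearMap.pi fun k => CK.int1.comp (ContinuousLinearMap.proj k)).comp π2
  have hXa : ∀ i, AnalyticAt ℝ (fun q : ℝ × (Fin d → CK) × (Fin d → CK) => XA i (π1 q)) 0 :=
    fun i => AnalyticAt.fun_comp (by rw [map_zero]; exact hX i) (π1.analyticAt 0)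
  have hJa : ∀ i j, AnalyticAt ℝ
      (fun q : ℝ × (Fin d → CK) × (Fin d → CK) => JA i j (κ q)) 0 :=
    fun i j => AnalyticAt.fun_comp (by rw [map_zero]; exact hJ i j) (κ.analyticAt 0)
  have hΨ : AnalyticAt ℝ (fun q : ℝ × (Fin d → CK) × (Fin d → CK) =>
      ((fun i => CK.int0 (XA i (π1 q)), fun i => ∑ j, JA i j (κ q) *
        (q.1 • CK.restrict (XA j (π1 q)) + CK.int1deriv0 (π2 q j))) :
        (Fin d → CK) × (Fin d → CK))) 0 := by
    refine AnalyticAt.prod (AnalyticAt.pi fun i => ?_) (AnalyticAt.pi fun i => ?_)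
    · exact (CK.int0.analyticAt _).fun_comp (hXa i)
    · refine Finset.analyticAt_fun_sum _ fun j _ => ?_
      refine (hJa i j).mul (AnalyticAt.add (AnalyticAt.smul analyticAt_fst
        ((CK.restrict.analyticAt _).fun_comp (hXa j))) ?_)
      exact ((CK.int1deriv0.comp (ContinuousLinearMap.proj j)).comp π2).analyticAt 0
  obtain ⟨δ, hδ, ⟨c, h⟩, hw, he⟩ := exists_small_fixedPoint hΨ hε
  refine ⟨δ, hδ, c, h, (norm_fst_le _).trans_lt hw, (norm_snd_le _).trans_lt hw, ?_, ?_⟩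
  · exact fun i => congrFun (congrArg Prod.fst he) i
  · exact fun i => congrFun (congrArg Prod.snd he) i

lemma exists_scaled_solution {d : ℕ} {X : Fin d → (Fin d → ℝ) → ℝ}
    {J : Fin d → Fin d → (Fin d → ℝ) → ℝ} (hX : ∀ i, AnalyticAt ℝ (X i) 0)
    (hJ : ∀ i j, AnalyticAt ℝ (J i j) 0) :
    ∃ δ > (0 : ℝ), ∃ u : ℝ × ℝ → Fin d → ℝ, AnalyticOnNhd ℝ u (ball 0 (1 / 2)) ∧ u 0 = 0 ∧
      (∀ z ∈ ball (0 : ℝ × ℝ) (1 / 2), ∀ i, fderiv ℝ u z (0, 1) i =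
        δ * ∑ j, J i j (u z) * fderiv ℝ u z (1, 0) j) ∧
      ∀ x : ℝ, (x, (0 : ℝ)) ∈ ball (0 : ℝ × ℝ) (1 / 2) → ∀ i,
        fderiv ℝ u (x, 0) (1, 0) i = δ * X i (u (x, 0)) := by
  choose XA hXA hXA' using fun i => exists_analyticAt_algebra CK (hX i)
  choose JA hJA hJA' using fun i j => exists_analyticAt_algebra CK (hJ i j)
  obtain ⟨r, hr, hball⟩ := Metric.eventually_nhds_iff_ball.1
    ((Filter.eventually_all.2 hXA').and
      (Filter.eventually_all.2 fun i => Filter.eventually_all.2 (hJA' i)))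
  have hK : 0 < 1 + ‖CK.int1‖ := by positivity
  obtain ⟨δ, hδ, c, h, hc, hh, ec, eh⟩ := CK.exists_solution hXA hJA (div_pos hr hK)
  have hle : r / (1 + ‖CK.int1‖) ≤ r := div_le_self hr.le (by linarith [norm_nonneg CK.int1])
  set a : Fin d → CK := fun k => c k + CK.int1 (h k) with ha
  have hcball : c ∈ ball 0 r := by
    rw [mem_ball_zero_iff]
    exact hc.trans_le hle
  have haball : a ∈ ball 0 r := by
    rw [mem_ball_zero_iff, pi_norm_lt_iff hr]
    intro i
    have h1 : ‖c i‖ < r / (1 + ‖CK.int1‖) := (norm_le_pi_norm c i).trans_lt hc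
    have h2 : ‖h i‖ ≤ r / (1 + ‖CK.int1‖) := ((norm_le_pi_norm h i).trans_lt hh).le
    calc ‖c i + CK.int1 (h i)‖ ≤ ‖c i‖ + ‖CK.int1 (h i)‖ := norm_add_le _ _
      _ ≤ ‖c i‖ + ‖CK.int1‖ * ‖h i‖ := by gcongr; exact CK.int1.le_opNorm _
      _ < r / (1 + ‖CK.int1‖) + ‖CK.int1‖ * (r / (1 + ‖CK.int1‖)) :=
        add_lt_add_of_lt_of_le h1 (mul_le_mul_of_nonneg_left h2 (norm_nonneg _))
      _ = r := by field_simp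
  have hb : ∀ z ∈ ball (0 : ℝ × ℝ) (1 / 2), |z.1| + |z.2| < 1 := by
    intro z hz
    have hz' := mem_ball_zero_iff.1 hz
    have hz1 : |z.1| ≤ ‖z‖ := norm_fst_le z
    have hz2 : |z.2| ≤ ‖z‖ := norm_snd_le z
    linarith
  have hsplit : ∀ z : ℝ × ℝ, |z.1| + |z.2| < 1 → ∀ i, CK.ev z (a i) =
      δ * CK.ev z (CK.int0 (XA i c)) + CK.ev z (CK.int1 (h i)) := by
    intro z hz i
    have h1 := map_add (CK.evHom z hz.le) (c i) (CK.int1 (h i))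
    have h2 := map_smul (CK.evHom z hz.le) δ (CK.int0 (XA i c))
    simp only [CK.evHom_apply, smul_eq_mul] at h1 h2
    rw [ha, h1, ec i, h2]
  have hopen : IsOpen {z : ℝ × ℝ | |z.1| + |z.2| < 1} :=
    isOpen_lt (by fun_prop) continuous_const
  have han : AnalyticOnNhd ℝ (fun z i => CK.ev z (a i)) (ball (0 : ℝ × ℝ) (1 / 2)) :=
    fun z hz => AnalyticAt.pi fun i => CK.analyticOnNhd_ev (a i) z hz
  have hx : ∀ z ∈ ball (0 : ℝ × ℝ) (1 / 2), ∀ i, fderiv ℝ (fun z i => CK.ev z (a i)) z (1, 0) i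
      = δ * CK.ev (z.1, 0) (XA i c) + CK.ev z (CK.int1deriv0 (h i)) := by
    intro z hz i
    have hd := (han z hz).differentiableAt.hasFDerivAt
    have hl : HasDerivAt (fun s : ℝ => (s, z.2)) ((1 : ℝ), (0 : ℝ)) z.1 :=
      (hasDerivAt_id _).prodMk (hasDerivAt_const _ _)
    have h1 := hasDerivAt_pi.1 (hd.comp_hasDerivAt z.1 hl) i
    have h2 := ((CK.hasDerivAt_int0 (hb z hz) (XA i c)).const_mul δ).add
      (CK.hasDerivAt_int1_fst (hb z hz) (h i))
    refine h1.unique (h2.congr_of_eventuallyEq ?_)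
    have : ∀ᶠ s in nhds z.1, (s, z.2) ∈ {z : ℝ × ℝ | |z.1| + |z.2| < 1} :=
      hl.continuousAt.eventually_mem (hopen.mem_nhds (hb z hz))
    filter_upwards [this] with s hs
    exact hsplit (s, z.2) hs i
  have hy : ∀ z ∈ ball (0 : ℝ × ℝ) (1 / 2), ∀ i, fderiv ℝ (fun z i => CK.ev z (a i)) z (0, 1) i
      = CK.ev z (h i) := by
    intro z hz i
    have hd := (han z hz).differentiableAt.hasFDerivAt
    have hl : HasDerivAt (fun s : ℝ => (z.1, s)) ((0 : ℝ), (1 : ℝ)) z.2 :=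
      (hasDerivAt_const _ _).prodMk (hasDerivAt_id _)
    have h1 := hasDerivAt_pi.1 (hd.comp_hasDerivAt z.2 hl) i
    have h2 := (CK.hasDerivAt_int1 (hb z hz) (h i)).const_add
      (δ * CK.ev (z.1, 0) (CK.int0 (XA i c)))
    refine h1.unique (h2.congr_of_eventuallyEq ?_)
    have : ∀ᶠ s in nhds z.2, (z.1, s) ∈ {z : ℝ × ℝ | |z.1| + |z.2| < 1} :=
      hl.continuousAt.eventually_mem (hopen.mem_nhds (hb z hz))
    filter_upwards [this] with s hs
    rw [← CK.ev_int0_eq z.1 s]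
    exact hsplit (z.1, s) hs i
  have hc0 : ∀ x : ℝ, |x| + |(0 : ℝ)| < 1 → ∀ i, CK.ev (x, 0) (a i) = CK.ev (x, 0) (c i) := by
    intro x hx i
    have h1 := map_add (CK.evHom (x, 0) hx.le) (c i) (CK.int1 (h i))
    simp only [CK.evHom_apply] at h1
    rw [ha, h1, CK.ev_int1_zero, add_zero]
  refine ⟨δ, hδ, fun z i => CK.ev z (a i), han, ?_, ?_, ?_⟩
  · funext i
    change CK.ev (0, 0) (a i) = 0
    rw [hsplit (0, 0) (by simp), CK.ev_int0_zero, CK.ev_int1_zero]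
    simp
  · intro z hz i
    rw [hy z hz i]
    simp only [hx z hz]
    have h1 := congrArg (CK.evHom z (hb z hz).le) (eh i)
    simp only [map_smul, map_sum, map_mul, map_add, smul_eq_mul] at h1
    rw [CK.evHom_apply] at h1
    rw [h1]
    congr 1
    refine Finset.sum_congr rfl fun j _ => ?_
    rw [(hball a haball).2 i j (CK.evHom z (hb z hz).le) (CK.abs_ev_le (hb z hz).le)]
    simp only [CK.evHom_apply]
    rw [show z = (z.1, z.2) from rfl, CK.ev_restrict]
  · intro x hx0 i
    have hb' := hb _ hx0
    rw [hx _ hx0 i, CK.ev_int1deriv0_zero, add_zero]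
    congr 1
    have h1 := (hball c hcball).1 i (CK.evHom (x, 0) hb'.le) (CK.abs_ev_le hb'.le)
    simp only [CK.evHom_apply] at h1
    simp only [hc0 x hb']
    exact h1

/-- Cauchy–Kovalevskaya for the system `∂γ/∂y = J(γ) ∂γ/∂x` with `γ(·, 0)` an integral curve
of `X` starting at `p`. -/
theorem exists_analytic_curve {E : Type*} [NormedAddCommGroup E] [NormedSpace ℝ E]
    [FiniteDimensional ℝ E] {J : E → E →L[ℝ] E} {X : E → E} {p : E} (hJ : AnalyticAt ℝ J p)
    (hX : AnalyticAt ℝ X p) :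
    ∃ ρ > (0 : ℝ), ∃ γ : ℝ × ℝ → E, AnalyticOnNhd ℝ γ (ball 0 ρ) ∧ γ 0 = p ∧
      (∀ z ∈ ball (0 : ℝ × ℝ) ρ, fderiv ℝ γ z (0, 1) = J (γ z) (fderiv ℝ γ z (1, 0))) ∧
      ∀ x : ℝ, (x, (0 : ℝ)) ∈ ball (0 : ℝ × ℝ) ρ → fderiv ℝ γ (x, 0) (1, 0) = X (γ (x, 0)) := by
  obtain ⟨d, ⟨e⟩⟩ : ∃ d : ℕ, Nonempty (E ≃L[ℝ] (Fin d → ℝ)) :=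
    ⟨Module.finrank ℝ E, ⟨ContinuousLinearEquiv.ofFinrankEq (by simp)⟩⟩
  have hτ : AnalyticAt ℝ (fun v : Fin d → ℝ => p + e.symm v) 0 :=
    analyticAt_const.add (e.symm.toContinuousLinearMap.analyticAt 0)
  have hX' : ∀ i, AnalyticAt ℝ (fun v : Fin d → ℝ => e (X (p + e.symm v)) i) 0 := fun i =>
    (((ContinuousLinearMap.proj i).comp e.toContinuousLinearMap).analyticAt _).fun_comp
      (AnalyticAt.fun_comp (by simpa using hX) hτ)
  have hJ' : ∀ i j, AnalyticAt ℝ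
      (fun v : Fin d → ℝ => e (J (p + e.symm v) (e.symm (Pi.single j 1))) i) 0 := fun i j =>
    (((ContinuousLinearMap.proj i).comp (e.toContinuousLinearMap.comp
      (ContinuousLinearMap.apply ℝ E (e.symm (Pi.single j 1))))).analyticAt _).fun_comp
      (AnalyticAt.fun_comp (by simpa using hJ) hτ)
  obtain ⟨δ, hδ, u, hu, hu0, huy, hux⟩ := exists_scaled_solution hX' hJ'
  let L : ℝ × ℝ →L[ℝ] ℝ × ℝ := (δ⁻¹ • ContinuousLinearMap.fst ℝ ℝ ℝ).prod
    ((δ⁻¹ * δ⁻¹) • ContinuousLinearMap.snd ℝ ℝ ℝ)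
  have hLx : ∀ x : ℝ, L (x, 0) = (δ⁻¹ * x, 0) := fun x => by simp [L]
  have hL1 : L (1, 0) = δ⁻¹ • ((1 : ℝ), (0 : ℝ)) := by simp [L]
  have hL2 : L (0, 1) = (δ⁻¹ * δ⁻¹) • ((0 : ℝ), (1 : ℝ)) := by simp [L]
  obtain ⟨ρ, hρ, hball⟩ := Metric.mem_nhds_iff.1
    (L.continuous.continuousAt.preimage_mem_nhds (x := 0) (t := ball 0 (1 / 2))
      (by rw [map_zero]; exact ball_mem_nhds 0 (by norm_num)))
  have hd : ∀ z ∈ ball (0 : ℝ × ℝ) ρ, ∀ v,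
      fderiv ℝ (fun z => p + e.symm (u (L z))) z v = e.symm (fderiv ℝ u (L z) (L v)) := by
    intro z hz v
    have h1 := (hu (L z) (hball hz)).differentiableAt.hasFDerivAt
    have h2 := (e.symm.toContinuousLinearMap.hasFDerivAt.comp z
      (h1.comp z L.hasFDerivAt)).const_add p
    exact congrArg (fun T : ℝ × ℝ →L[ℝ] E => T v) h2.fderiv
  refine ⟨ρ, hρ, fun z => p + e.symm (u (L z)), fun z hz => ?_, by simp [hu0], ?_, ?_⟩
  · exact analyticAt_const.add ((e.symm.toContinuousLinearMap.analyticAt _).fun_comp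
      ((hu (L z) (hball hz)).fun_comp (L.analyticAt z)))
  · intro z hz
    rw [hd z hz, hd z hz, hL1, hL2]
    apply e.injective
    funext i
    have h1 := huy (L z) (hball hz) i
    set T := e.toContinuousLinearMap.comp
      ((J (p + e.symm (u (L z)))).comp e.symm.toContinuousLinearMap) with hT
    have h2 : ∀ w, e (J (p + e.symm (u (L z))) (e.symm w)) = T w := fun w => rfl
    have h3 : ∀ w : Fin d → ℝ, T w i = ∑ j, T (Pi.single j 1) i * w j := by
      intro w
      conv_lhs => rw [pi_eq_sum_univ' w]
      rw [map_sum, Finset.sum_apply]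
      refine Finset.sum_congr rfl fun j _ => ?_
      rw [map_smul, Pi.smul_apply, smul_eq_mul, mul_comm]
    simp only [map_smul, e.apply_symm_apply, h2, Pi.smul_apply, smul_eq_mul] at h1 ⊢
    rw [h3, h1]
    field_simp
  · intro x hx
    rw [hd _ hx, hL1, map_smul]
    apply e.injective
    funext i
    have h0 := hball hx
    rw [Set.mem_preimage, hLx] at h0
    simp only
    rw [e.apply_symm_apply, Pi.smul_apply, hLx, hux _ h0 i, smul_eq_mul,
      inv_mul_cancel_left₀ hδ.ne']

lemma lieVF_eq_lieBracket (X Y : F → F) : lieVF X Y = VectorField.lieBracket ℝ X Y := rfl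

open scoped ContDiff in
/-- A real hypersurface `{φ = 0}` in an open set carrying an integrable real analytic almost
complex structure. -/
structure IsIntegrableHypersurface (U : Set F) (J : F → F →L[ℝ] F) (φ : F → ℝ) : Prop where
  isOpen : IsOpen U
  analytic_J : AnalyticOnNhd ℝ J U
  sq : ∀ x ∈ U, (J x).comp (J x) = -ContinuousLinearMap.id ℝ F
  nijenhuis : ∀ Y Z : F → F, ContDiff ℝ ∞ Y → ContDiff ℝ ∞ Z → ∀ q ∈ U,
    lieVF (Jvf J Y) (Jvf J Z) q - J q (lieVF (Jvf J Y) Z q) - J q (lieVF Y (Jvf J Z) q)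
      - lieVF Y Z q = 0
  analytic_φ : AnalyticOnNhd ℝ φ U
  fderiv_ne : ∀ q ∈ U, φ q = 0 → fderiv ℝ φ q ≠ 0

/-- Analytic vector fields in `T^J M`. -/
structure IsTangent (U : Set F) (J : F → F →L[ℝ] F) (φ : F → ℝ) (Y : F → F) : Prop where
  analytic : AnalyticOnNhd ℝ Y U
  inTJM : InTJM J φ U Y

/-- Analytic vector fields in `T^J M` whose brackets with all such fields stay in `T^J M`. -/
structure IsLeviKernel (U : Set F) (J : F → F →L[ℝ] F) (φ : F → ℝ) (Z : F → F) : Prop where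
  isTangent : IsTangent U J φ Z
  lie_mem : ∀ Y, IsTangent U J φ Y → InTJM J φ U (lieVF Z Y)

variable {U : Set F} {J : F → F →L[ℝ] F} {φ : F → ℝ}

lemma AnalyticAt.clm_apply_field {E G H : Type*} [NormedAddCommGroup E] [NormedSpace ℝ E]
    [NormedAddCommGroup G] [NormedSpace ℝ G] [NormedAddCommGroup H] [NormedSpace ℝ H]
    {A : E → G →L[ℝ] H} {v : E → G} {q : E} (hA : AnalyticAt ℝ A q) (hv : AnalyticAt ℝ v q) :
    AnalyticAt ℝ (fun x => A x (v x)) q :=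
  AnalyticAt.fun_comp (g := fun p : (G →L[ℝ] H) × G => p.1 p.2) (f := fun x => (A x, v x))
    ((ContinuousLinearMap.id ℝ (G →L[ℝ] H)).analyticAt_bilinear (A q, v q)) (hA.prod hv)

lemma AnalyticOnNhd.Jvf (hJ : AnalyticOnNhd ℝ J U) {Y : F → F} (hY : AnalyticOnNhd ℝ Y U) :
    AnalyticOnNhd ℝ (Jvf J Y) U := fun q hq => (hJ q hq).clm_apply_field (hY q hq)

lemma AnalyticOnNhd.lieVF [CompleteSpace F] {Y Z : F → F} (hY : AnalyticOnNhd ℝ Y U)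
    (hZ : AnalyticOnNhd ℝ Z U) : AnalyticOnNhd ℝ (lieVF Y Z) U := fun q hq =>
  (AnalyticAt.clm_apply_field (hZ.fderiv q hq) (hY q hq)).sub
    (AnalyticAt.clm_apply_field (hY.fderiv q hq) (hZ q hq))

lemma fderiv_Jvf {Y : F → F} {q : F} (hJ : DifferentiableAt ℝ J q)
    (hY : DifferentiableAt ℝ Y q) (w : F) :
    fderiv ℝ (Jvf J Y) q w = fderiv ℝ J q w (Y q) + J q (fderiv ℝ Y q w) := by
  have h := (hJ.hasFDerivAt.clm_apply hY.hasFDerivAt).fderiv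
  change fderiv ℝ (fun p => J p (Y p)) q w = _
  rw [h]
  simp [add_comm]

namespace IsIntegrableHypersurface

lemma sq_apply (S : IsIntegrableHypersurface U J φ) {q : F} (hq : q ∈ U) (v : F) : J q (J q v) = -v :=
  congrArg (fun T : F →L[ℝ] F => T v) (S.sq q hq)

/-- The Nijenhuis identity only depends on one-jets. -/
lemma lieVF_Jvf_Jvf (S : IsIntegrableHypersurface U J φ) {Y Z : F → F} {q : F} (hq : q ∈ U)
    (hY : DifferentiableAt ℝ Y q)
    (hZ : DifferentiableAt ℝ Z q) : lieVF (Jvf J Y) (Jvf J Z) q =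
      J q (lieVF (Jvf J Y) Z q) + J q (lieVF Y (Jvf J Z) q) + lieVF Y Z q := by
  have hJ := (S.analytic_J q hq).differentiableAt
  have key : ∀ Y : F → F, ∃ Y' : F → F, ContDiff ℝ ⊤ Y' ∧ Y' q = Y q ∧
      fderiv ℝ Y' q = fderiv ℝ Y q := by
    intro Y
    refine ⟨fun x => Y q + fderiv ℝ Y q (x - q), by fun_prop, by simp, ?_⟩
    have h1 := ((fderiv ℝ Y q).hasFDerivAt.comp q ((hasFDerivAt_id q).sub_const q)).const_add (Y q)
    exact h1.fderiv
  obtain ⟨Y', hY', hY0, hY1⟩ := key Y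
  obtain ⟨Z', hZ', hZ0, hZ1⟩ := key Z
  have hN := S.nijenhuis Y' Z' (hY'.of_le le_top) (hZ'.of_le le_top) q hq
  have dY' : DifferentiableAt ℝ Y' q := hY'.differentiable (by simp) q
  have dZ' : DifferentiableAt ℝ Z' q := hZ'.differentiable (by simp) q
  simp only [lieVF, fderiv_Jvf hJ hY, fderiv_Jvf hJ hZ, fderiv_Jvf hJ dY', fderiv_Jvf hJ dZ',
    Jvf, hY0, hZ0, hY1, hZ1] at hN ⊢
  rw [← sub_eq_zero, ← hN]
  abel

/-- Functions vanishing on the hypersurface have differential vanishing on its tangent space. -/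
lemma fderiv_eq_zero_of_vanishing [CompleteSpace F] (S : IsIntegrableHypersurface U J φ)
    {f : F → ℝ} (hf : AnalyticOnNhd ℝ f U)
    (hf0 : ∀ q ∈ U, φ q = 0 → f q = 0) {q v : F} (hq : q ∈ U) (hφ : φ q = 0)
    (hv : fderiv ℝ φ q v = 0) : fderiv ℝ f q v = 0 := by
  have hext : IsLocalExtrOn f {x | φ x = φ q} q := by
    left
    filter_upwards [self_mem_nhdsWithin, mem_nhdsWithin_of_mem_nhds (S.isOpen.mem_nhds hq)]
      with x hx hxU
    rw [hf0 q hq hφ, hf0 x hxU (hx.trans hφ)]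
  obtain ⟨a, b, hab, h⟩ := hext.exists_multipliers_of_hasStrictFDerivAt_1d
    (S.analytic_φ q hq).hasStrictFDerivAt (hf q hq).hasStrictFDerivAt
  have hb : b ≠ 0 := by
    rintro rfl
    have ha : a ≠ 0 := fun ha => hab (by simp [ha])
    rw [zero_smul, add_zero, smul_eq_zero] at h
    exact S.fderiv_ne q hq hφ (h.resolve_left ha)
  have h1 := congrArg (fun T : F →L[ℝ] ℝ => T v) h
  simpa [hv, hb] using h1

lemma fderiv_lieVF_eq_zero [CompleteSpace F] (S : IsIntegrableHypersurface U J φ)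
    {A B : F → F} (hA : AnalyticOnNhd ℝ A U)
    (hB : AnalyticOnNhd ℝ B U) (hA0 : ∀ q ∈ U, φ q = 0 → fderiv ℝ φ q (A q) = 0)
    (hB0 : ∀ q ∈ U, φ q = 0 → fderiv ℝ φ q (B q) = 0) {q : F} (hq : q ∈ U) (hφ : φ q = 0) :
    fderiv ℝ φ q (lieVF A B q) = 0 := by
  have key : ∀ {A B : F → F}, AnalyticOnNhd ℝ B U →
      (∀ q ∈ U, φ q = 0 → fderiv ℝ φ q (A q) = 0) →
      (∀ q ∈ U, φ q = 0 → fderiv ℝ φ q (B q) = 0) →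
      fderiv ℝ (fderiv ℝ φ) q (A q) (B q) + fderiv ℝ φ q (fderiv ℝ B q (A q)) = 0 := by
    intro A B hB hA0 hB0
    have h1 := S.fderiv_eq_zero_of_vanishing (f := fun q => fderiv ℝ φ q (B q))
      (fun q hq => (S.analytic_φ.fderiv q hq).clm_apply_field (hB q hq)) hB0 hq hφ (hA0 q hq hφ)
    rw [fderiv_clm_apply (S.analytic_φ.fderiv q hq).differentiableAt
      (hB q hq).differentiableAt] at h1
    simpa [add_comm] using h1
  have h1 := key hB hA0 hB0
  have h2 := key hA hB0 hA0
  have hs := (S.analytic_φ q hq).contDiffAt.isSymmSndFDerivAt_of_omega (A q) (B q)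
  rw [lieVF, map_sub]
  linarith

end IsIntegrableHypersurface

namespace IsTangent

lemma Jvf (S : IsIntegrableHypersurface U J φ) {Y : F → F} (hY : IsTangent U J φ Y) :
    IsTangent U J φ (Jvf J Y) where
  analytic := S.analytic_J.Jvf hY.analytic
  inTJM q hq hφ := by
    obtain ⟨h1, h2⟩ := hY.inTJM q hq hφ
    refine ⟨h2, ?_⟩
    change fderiv ℝ φ q (J q (J q (Y q))) = 0
    rw [S.sq_apply hq, map_neg, h1, neg_zero]

lemma fderiv_lieVF [CompleteSpace F] (S : IsIntegrableHypersurface U J φ) {Y Z : F → F}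
    (hY : IsTangent U J φ Y) (hZ : IsTangent U J φ Z) {q : F} (hq : q ∈ U) (hφ : φ q = 0) :
    fderiv ℝ φ q (lieVF Y Z q) = 0 :=
  S.fderiv_lieVF_eq_zero hY.analytic hZ.analytic (fun q hq h => (hY.inTJM q hq h).1)
    (fun q hq h => (hZ.inTJM q hq h).1) hq hφ

lemma isLeviKernel [CompleteSpace F] (S : IsIntegrableHypersurface U J φ) {X : F → F}
    (hX : IsTangent U J φ X)
    (h : ∀ Y, IsTangent U J φ Y → ∀ q ∈ U, φ q = 0 → levihat J φ X Y q = 0) :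
    IsLeviKernel U J φ X where
  isTangent := hX
  lie_mem Y hY q hq hφ := by
    refine ⟨hX.fderiv_lieVF S hY hq hφ, ?_⟩
    have h1 := congrArg Complex.im (h Y hY q hq hφ)
    simp only [levihat, Complex.add_im, Complex.ofReal_im, Complex.mul_im, Complex.I_re,
      Complex.I_im, Complex.ofReal_re, Complex.zero_im, zero_mul, zero_add, one_mul] at h1
    rw [S.lieVF_Jvf_Jvf hq (hX.analytic q hq).differentiableAt
      (hY.analytic q hq).differentiableAt] at h1
    simp only [map_add, S.sq_apply hq, map_neg] at h1
    have h2 := (hX.Jvf S).fderiv_lieVF S hY hq hφ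
    have h3 := hX.fderiv_lieVF S (hY.Jvf S) hq hφ
    linarith

end IsTangent

namespace IsLeviKernel

lemma Jvf [CompleteSpace F] (S : IsIntegrableHypersurface U J φ) {Z : F → F}
    (hZ : IsLeviKernel U J φ Z) : IsLeviKernel U J φ (Jvf J Z) where
  isTangent := hZ.isTangent.Jvf S
  lie_mem Y hY q hq hφ := by
    refine ⟨(hZ.isTangent.Jvf S).fderiv_lieVF S hY hq hφ, ?_⟩
    have h1 := congrArg (fderiv ℝ φ q) (S.lieVF_Jvf_Jvf hq
      (hZ.isTangent.analytic q hq).differentiableAt (hY.analytic q hq).differentiableAt)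
    have h2 := (hZ.isTangent.Jvf S).fderiv_lieVF S (hY.Jvf S) hq hφ
    have h3 := (hZ.lie_mem _ (hY.Jvf S) q hq hφ).2
    have h4 := hZ.isTangent.fderiv_lieVF S hY hq hφ
    simp only [map_add] at h1
    linarith

lemma zero : IsLeviKernel U J φ 0 where
  isTangent := ⟨analyticOnNhd_const, fun q _ _ => by simp⟩
  lie_mem Y _ q _ _ := by simp [lieVF_eq_lieBracket]

lemma add {Z W : F → F} (hZ : IsLeviKernel U J φ Z) (hW : IsLeviKernel U J φ W) :
    IsLeviKernel U J φ (Z + W) where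
  isTangent := ⟨hZ.isTangent.analytic.add hW.isTangent.analytic, fun q hq hφ => by
    simp [hZ.isTangent.inTJM q hq hφ, hW.isTangent.inTJM q hq hφ]⟩
  lie_mem Y hY q hq hφ := by
    rw [lieVF_eq_lieBracket, VectorField.lieBracket_add_left
      (hZ.isTangent.analytic q hq).differentiableAt (hW.isTangent.analytic q hq).differentiableAt]
    have h1 := hZ.lie_mem Y hY q hq hφ
    have h2 := hW.lie_mem Y hY q hq hφ
    rw [lieVF_eq_lieBracket] at h1 h2
    simp [h1, h2]

lemma const_smul {Z : F → F} (hZ : IsLeviKernel U J φ Z) (c : ℝ) :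
    IsLeviKernel U J φ (c • Z) where
  isTangent := ⟨hZ.isTangent.analytic.const_smul, fun q hq hφ => by
    simp [hZ.isTangent.inTJM q hq hφ]⟩
  lie_mem Y hY q hq hφ := by
    rw [lieVF_eq_lieBracket, VectorField.lieBracket_const_smul_left
      (hZ.isTangent.analytic q hq).differentiableAt]
    have h1 := hZ.lie_mem Y hY q hq hφ
    rw [lieVF_eq_lieBracket] at h1
    simp [h1]

lemma sum {ι : Type*} (s : Finset ι) {Z : ι → F → F} (hZ : ∀ i, IsLeviKernel U J φ (Z i)) :
    IsLeviKernel U J φ (∑ i ∈ s, Z i) := by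
  classical
  induction s using Finset.induction_on with
  | empty => simpa using zero
  | insert i s hi ih =>
    rw [Finset.sum_insert hi]
    exact (hZ i).add ih

lemma lieVF [CompleteSpace F] {Z W : F → F}
    (hZ : IsLeviKernel U J φ Z) (hW : IsLeviKernel U J φ W) :
    IsLeviKernel U J φ (lieVF Z W) where
  isTangent := ⟨hZ.isTangent.analytic.lieVF hW.isTangent.analytic, hZ.lie_mem W hW.isTangent⟩
  lie_mem Y hY q hq hφ := by
    have hWY : IsTangent U J φ (_root_.lieVF W Y) :=
      ⟨hW.isTangent.analytic.lieVF hY.analytic, hW.lie_mem Y hY⟩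
    have hZY : IsTangent U J φ (_root_.lieVF Z Y) :=
      ⟨hZ.isTangent.analytic.lieVF hY.analytic, hZ.lie_mem Y hY⟩
    have h := VectorField.leibniz_identity_lieBracket (𝕜 := ℝ) (n := 2) (by simp)
      (hZ.isTangent.analytic q hq).contDiffAt (hW.isTangent.analytic q hq).contDiffAt
      (hY.analytic q hq).contDiffAt
    have h1 := hZ.lie_mem _ hWY q hq hφ
    have h2 := hW.lie_mem _ hZY q hq hφ
    simp only [lieVF_eq_lieBracket] at h1 h2 ⊢
    rw [eq_sub_of_add_eq h.symm]
    simp [h1, h2]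

end IsLeviKernel

/-- The coefficients of the formal expansion `γ_x = ∑ y ^ k Z_k(γ)` for solutions of
`γ_y = J(γ) γ_x`. -/
def jetField (J : F → F →L[ℝ] F) (X : F → F) : ℕ → F → F
  | 0 => X
  | k + 1 => ((k : ℝ) + 1)⁻¹ • ∑ i : Fin (k + 1),
      lieVF (jetField J X i) (Jvf J (jetField J X (k - i)))
  decreasing_by all_goals omega

lemma jetField_zero (J : F → F →L[ℝ] F) (X : F → F) : jetField J X 0 = X := by
  rw [jetField]

lemma jetField_succ (J : F → F →L[ℝ] F) (X : F → F) (k : ℕ) :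
    jetField J X (k + 1) = ((k : ℝ) + 1)⁻¹ • ∑ i : Fin (k + 1),
      lieVF (jetField J X i) (Jvf J (jetField J X (k - i))) := by
  rw [jetField]

lemma IsLeviKernel.jetField [CompleteSpace F] (S : IsIntegrableHypersurface U J φ) {X : F → F}
    (hX : IsLeviKernel U J φ X) (k : ℕ) : IsLeviKernel U J φ (jetField J X k) := by
  induction k using Nat.strong_induction_on with
  | _ k ih =>
    cases k with
    | zero => rwa [jetField_zero]
    | succ k =>
      rw [jetField_succ]
      exact (IsLeviKernel.sum _ fun i : Fin (k + 1) => (ih i i.2).lieVF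
        ((ih (k - i) (by omega)).Jvf S)).const_smul _

/-- Vanishing to order `N` along the first axis. -/
def IsFlat {G : Type*} [NormedAddCommGroup G] [NormedSpace ℝ G] (D : Set (ℝ × ℝ)) :
    ℕ → (ℝ × ℝ → G) → Prop
  | 0, _ => True
  | N + 1, f => (∀ x : ℝ, (x, (0 : ℝ)) ∈ D → f (x, 0) = 0) ∧
      IsFlat D N (fun z => fderiv ℝ f z (0, 1))

section Flat

variable {G H : Type*} [NormedAddCommGroup G] [NormedSpace ℝ G] [NormedAddCommGroup H]
  [NormedSpace ℝ H] {D : Set (ℝ × ℝ)} {N : ℕ}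

lemma fderiv_eqOn {f g : ℝ × ℝ → G} (hD : IsOpen D) (h : Set.EqOn f g D) {z : ℝ × ℝ}
    (hz : z ∈ D) : fderiv ℝ f z = fderiv ℝ g z :=
  (h.eventuallyEq_of_mem (hD.mem_nhds hz)).fderiv_eq

lemma AnalyticOnNhd.fderiv_apply_const [CompleteSpace G] {f : ℝ × ℝ → G}
    (hf : AnalyticOnNhd ℝ f D) (v : ℝ × ℝ) :
    AnalyticOnNhd ℝ (fun z => fderiv ℝ f z v) D :=
  fun z hz => (hf.fderiv z hz).clm_apply_field analyticAt_const

namespace IsFlat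

lemma congr (hD : IsOpen D) {f g : ℝ × ℝ → G} (hf : IsFlat D N f) (h : Set.EqOn f g D) :
    IsFlat D N g := by
  induction N generalizing f g with
  | zero => trivial
  | succ N ih =>
    exact ⟨fun x hx => (h hx).symm.trans (hf.1 x hx),
      ih hf.2 fun z hz => by simp only [fderiv_eqOn hD h hz]⟩

lemma of_succ {f : ℝ × ℝ → G} (hf : IsFlat D (N + 1) f) : IsFlat D N f := by
  induction N generalizing f with
  | zero => trivial
  | succ N ih => exact ⟨hf.1, ih hf.2⟩

lemma zero (hD : IsOpen D) : IsFlat D N (fun _ => (0 : G)) := by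
  induction N with
  | zero => trivial
  | succ N ih => exact ⟨fun _ _ => rfl, ih.congr hD fun z _ => by simp⟩

lemma add [CompleteSpace G] (hD : IsOpen D) {f g : ℝ × ℝ → G} (hf : AnalyticOnNhd ℝ f D)
    (hg : AnalyticOnNhd ℝ g D) (hf' : IsFlat D N f) (hg' : IsFlat D N g) :
    IsFlat D N (fun z => f z + g z) := by
  induction N generalizing f g with
  | zero => trivial
  | succ N ih =>
    refine ⟨fun x hx => by simp only [hf'.1 x hx, hg'.1 x hx, add_zero],
      (ih (hf.fderiv_apply_const _) (hg.fderiv_apply_const _) hf'.2 hg'.2).congr hD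
        fun z hz => ?_⟩
    simp only
    rw [fderiv_fun_add (hf z hz).differentiableAt (hg z hz).differentiableAt]
    rfl

lemma sum [CompleteSpace G] (hD : IsOpen D) {ι : Type*} (s : Finset ι) {f : ι → ℝ × ℝ → G}
    (hf : ∀ i ∈ s, AnalyticOnNhd ℝ (f i) D) (hf' : ∀ i ∈ s, IsFlat D N (f i)) :
    IsFlat D N (fun z => ∑ i ∈ s, f i z) := by
  classical
  induction s using Finset.induction_on with
  | empty => simpa using zero hD
  | insert i s hi ih =>
    simp only [Finset.sum_insert hi]
    refine (hf' i (Finset.mem_insert_self i s)).add hD (hf i (Finset.mem_insert_self i s)) ?_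
      (ih (fun j hj => hf j (Finset.mem_insert_of_mem hj))
        fun j hj => hf' j (Finset.mem_insert_of_mem hj))
    exact fun z hz => Finset.analyticAt_fun_sum s
      fun j hj => hf j (Finset.mem_insert_of_mem hj) z hz

lemma clm_apply [CompleteSpace G] [CompleteSpace H] (hD : IsOpen D) {A : ℝ × ℝ → G →L[ℝ] H}
    {f : ℝ × ℝ → G} (hA : AnalyticOnNhd ℝ A D) (hf : AnalyticOnNhd ℝ f D) (hf' : IsFlat D N f) :
    IsFlat D N (fun z => A z (f z)) := by
  induction N generalizing A f with
  | zero => trivial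
  | succ N ih =>
    refine ⟨fun x hx => by simp only [hf'.1 x hx, map_zero], ?_⟩
    have h1 := ih (hA.fderiv_apply_const (0, 1)) hf hf'.of_succ
    have h2 := ih hA (hf.fderiv_apply_const (0, 1)) hf'.2
    refine (h1.add hD (fun z hz => (hA.fderiv_apply_const (0, 1) z hz).clm_apply_field (hf z hz))
      (fun z hz => (hA z hz).clm_apply_field (hf.fderiv_apply_const (0, 1) z hz)) h2).congr hD
      fun z hz => ?_
    simp only
    rw [fderiv_clm_apply (hA z hz).differentiableAt (hf z hz).differentiableAt]
    simp [add_comm]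

lemma pow_mul_smul [CompleteSpace G] (hD : IsOpen D) {f : ℝ × ℝ → G}
    (hf : AnalyticOnNhd ℝ f D) (hf' : IsFlat D N f) (k : ℕ) :
    IsFlat D N (fun z => z.2 ^ k • f z) :=
  hf'.clm_apply hD (A := fun z => z.2 ^ k • ContinuousLinearMap.id ℝ G)
    (fun _ _ => (analyticAt_snd.pow k).smul analyticAt_const) hf

lemma sub [CompleteSpace G] (hD : IsOpen D) {f g : ℝ × ℝ → G} (hf : AnalyticOnNhd ℝ f D)
    (hg : AnalyticOnNhd ℝ g D) (hf' : IsFlat D N f) (hg' : IsFlat D N g) :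
    IsFlat D N (fun z => f z - g z) := by
  have h := hg'.clm_apply hD (A := fun _ => -ContinuousLinearMap.id ℝ G)
    (fun _ _ => analyticAt_const) hg
  refine (hf'.add hD hf (fun z hz => analyticAt_const.clm_apply_field (hg z hz)) h).congr hD
    fun z _ => ?_
  simp [sub_eq_add_neg]

lemma fderiv_fst [CompleteSpace G] (hD : IsOpen D) {f : ℝ × ℝ → G} (hf : AnalyticOnNhd ℝ f D)
    (hf' : IsFlat D N f) : IsFlat D N (fun z => fderiv ℝ f z (1, 0)) := by
  induction N generalizing f with
  | zero => trivial
  | succ N ih =>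
    refine ⟨fun x hx => ?_, (ih (hf.fderiv_apply_const (0, 1)) hf'.2).congr hD fun z hz => ?_⟩
    · have hl : HasDerivAt (fun s : ℝ => (s, (0 : ℝ))) ((1 : ℝ), (0 : ℝ)) x :=
        (hasDerivAt_id _).prodMk (hasDerivAt_const _ _)
      have h1 := (hf _ hx).differentiableAt.hasFDerivAt.comp_hasDerivAt x hl
      refine h1.unique ((hasDerivAt_const x (0 : G)).congr_of_eventuallyEq ?_)
      filter_upwards [hl.continuousAt.eventually_mem (hD.mem_nhds hx)] with s hs
      exact hf'.1 s hs
    · have hd := (hf.fderiv z hz).differentiableAt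
      have hs := (hf z hz).contDiffAt.isSymmSndFDerivAt_of_omega (1, 0) (0, 1)
      simp only
      rw [fderiv_clm_apply hd (differentiableAt_const _),
        fderiv_clm_apply hd (differentiableAt_const _)]
      simpa using hs

end IsFlat

lemma isFlat_pow_smul [CompleteSpace G] (hD : IsOpen D) {f : ℝ × ℝ → G}
    (hf : AnalyticOnNhd ℝ f D) : IsFlat D N (fun z => z.2 ^ N • f z) := by
  induction N generalizing f with
  | zero => trivial
  | succ N ih =>
    refine ⟨fun x hx => by simp, ?_⟩
    have hf1 : AnalyticOnNhd ℝ (fun z => ((N : ℝ) + 1) • f z + z.2 • fderiv ℝ f z (0, 1)) D :=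
      fun z hz => (analyticAt_const.smul (hf z hz)).add
        (analyticAt_snd.smul (hf.fderiv_apply_const (0, 1) z hz))
    refine (ih hf1).congr hD fun z hz => ?_
    have h1 : HasFDerivAt (fun z : ℝ × ℝ => z.2 ^ (N + 1)) _ z :=
      (hasFDerivAt_snd (𝕜 := ℝ) (p := z)).pow (N + 1)
    have h2 := h1.smul (hf z hz).differentiableAt.hasFDerivAt
    have h3 : fderiv ℝ (fun z => z.2 ^ (N + 1) • f z) z = _ := h2.fderiv
    simp only
    rw [h3]
    simp [smul_smul, pow_succ, mul_comm]
    abel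

end Flat

lemma sum_sum_range_pow_smul {G : Type*} [AddCommGroup G] [Module ℝ G] (N : ℕ) (y : ℝ)
    (c : ℕ → ℕ → G) :
    ∑ i ∈ Finset.range N, ∑ k ∈ Finset.range N, y ^ (i + k) • c i k =
      ∑ m ∈ Finset.range N, y ^ m • ∑ i ∈ Finset.range (m + 1), c i (m - i) +
      ∑ i ∈ Finset.range N, ∑ k ∈ Finset.Ico (N - i) N, y ^ (i + k) • c i k := by
  have h1 : ∑ m ∈ Finset.range N, y ^ m • ∑ i ∈ Finset.range (m + 1), c i (m - i) =
      ∑ i ∈ Finset.range N, ∑ k ∈ Finset.range (N - i), y ^ (i + k) • c i k := by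
    rw [← Finset.sum_range_diag_flip]
    refine Finset.sum_congr rfl fun m _ => ?_
    rw [Finset.smul_sum]
    refine Finset.sum_congr rfl fun i hi => ?_
    rw [Nat.add_sub_cancel' (Nat.lt_succ_iff.mp (Finset.mem_range.mp hi))]
  rw [h1, ← Finset.sum_add_distrib]
  exact Finset.sum_congr rfl fun i _ =>
    (Finset.sum_range_add_sum_Ico _ (Nat.sub_le N i)).symm

section Jets

variable {D : Set (ℝ × ℝ)} {γ : ℝ × ℝ → F}

/-- The difference of `∂γ/∂x` and the `N`-th partial sum of `∑ yᵏ Z k` along `γ`. -/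
def jetRemainder (Z : ℕ → F → F) (γ : ℝ × ℝ → F) (N : ℕ) (z : ℝ × ℝ) : F :=
  fderiv ℝ γ z (1, 0) - ∑ k ∈ Finset.range N, z.2 ^ k • Z k (γ z)

lemma analyticOnNhd_jetRemainder [CompleteSpace F] {Z : ℕ → F → F}
    (hγ : AnalyticOnNhd ℝ γ D) (hγU : Set.MapsTo γ D U) (hZ : ∀ k, AnalyticOnNhd ℝ (Z k) U)
    (N : ℕ) : AnalyticOnNhd ℝ (jetRemainder Z γ N) D := fun z hz =>
  (hγ.fderiv_apply_const (1, 0) z hz).sub <| Finset.analyticAt_fun_sum _ fun k _ =>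
    (analyticAt_snd.pow k).smul ((hZ k _ (hγU hz)).comp (hγ z hz))

lemma fderiv_pow_smul_comp {Y : F → F} {z : ℝ × ℝ} (hγ : DifferentiableAt ℝ γ z)
    (hY : DifferentiableAt ℝ Y (γ z)) (k : ℕ) (v : ℝ × ℝ) :
    fderiv ℝ (fun z => z.2 ^ k • Y (γ z)) z v =
      (k * z.2 ^ (k - 1) * v.2) • Y (γ z) + z.2 ^ k • fderiv ℝ Y (γ z) (fderiv ℝ γ z v) := by
  have h1 : HasFDerivAt (fun z : ℝ × ℝ => z.2 ^ k) _ z :=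
    (hasFDerivAt_snd (𝕜 := ℝ) (p := z)).pow k
  have h2 := h1.smul (hY.hasFDerivAt.comp z hγ.hasFDerivAt)
  have h3 : fderiv ℝ (fun z => z.2 ^ k • Y (γ z)) z = _ := h2.fderiv
  rw [h3]
  simp [add_comm, mul_assoc]

lemma isFlat_jetRemainder [CompleteSpace F] {Z : ℕ → F → F} (hD : IsOpen D)
    (hJ : AnalyticOnNhd ℝ J U) (hZ : ∀ k, AnalyticOnNhd ℝ (Z k) U)
    (hrec : ∀ m : ℕ, ∀ q, ((m : ℝ) + 1) • Z (m + 1) q =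
      ∑ i ∈ Finset.range (m + 1), lieVF (Z i) (Jvf J (Z (m - i))) q)
    (hγ : AnalyticOnNhd ℝ γ D) (hγU : Set.MapsTo γ D U)
    (hγJ : ∀ z ∈ D, fderiv ℝ γ z (0, 1) = J (γ z) (fderiv ℝ γ z (1, 0)))
    (hγX : ∀ x : ℝ, (x, (0 : ℝ)) ∈ D → fderiv ℝ γ (x, 0) (1, 0) = Z 0 (γ (x, 0))) (N : ℕ) :
    IsFlat D N (jetRemainder Z γ N) := by
  have hJZ : ∀ k, AnalyticOnNhd ℝ (Jvf J (Z k)) U := fun k => hJ.Jvf (hZ k)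
  induction N with
  | zero => trivial
  | succ N ih =>
    have he := analyticOnNhd_jetRemainder hγ hγU hZ N
    have hJγ : AnalyticOnNhd ℝ (fun z => J (γ z)) D := hJ.comp hγ hγU
    have hH : AnalyticOnNhd ℝ (fun z => J (γ z) (jetRemainder Z γ N z)) D :=
      fun z hz => (hJγ z hz).clm_apply_field (he z hz)
    have ihH := ih.clm_apply hD hJγ he
    set e := jetRemainder Z γ N with hedef
    set H := fun z => J (γ z) (e z) with hHdef
    have hu : ∀ z, fderiv ℝ γ z (1, 0) = ∑ i ∈ Finset.range N, z.2 ^ i • Z i (γ z) + e z :=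
      fun z => by simp [hedef, jetRemainder]
    have hw : ∀ z ∈ D, fderiv ℝ γ z (0, 1) =
        ∑ i ∈ Finset.range N, z.2 ^ i • Jvf J (Z i) (γ z) + H z := fun z hz => by
      rw [hγJ z hz, hu z, map_add, map_sum]
      simp [hHdef, Jvf]
    have hdJZ : ∀ k, AnalyticOnNhd ℝ (fun z => fderiv ℝ (Jvf J (Z k)) (γ z)) D :=
      fun k => (hJZ k).fderiv.comp hγ hγU
    have hdZ : ∀ k, AnalyticOnNhd ℝ (fun z => fderiv ℝ (Z k) (γ z)) D :=
      fun k => (hZ k).fderiv.comp hγ hγU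
    have a1 : AnalyticOnNhd ℝ (fun z => ∑ i ∈ Finset.range N, ∑ k ∈ Finset.Ico (N - i) N,
        z.2 ^ (i + k) • lieVF (Z i) (Jvf J (Z k)) (γ z)) D := fun z hz =>
      Finset.analyticAt_fun_sum _ fun i _ => Finset.analyticAt_fun_sum _ fun k _ =>
        (analyticAt_snd.pow _).smul (((hZ i).lieVF (hJZ k) _ (hγU hz)).comp (hγ z hz))
    have f1 : IsFlat D N (fun z => ∑ i ∈ Finset.range N, ∑ k ∈ Finset.Ico (N - i) N,
        z.2 ^ (i + k) • lieVF (Z i) (Jvf J (Z k)) (γ z)) := by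
      refine IsFlat.sum hD _ (fun i _ z hz => Finset.analyticAt_fun_sum _ fun k _ =>
        (analyticAt_snd.pow _).smul (((hZ i).lieVF (hJZ k) _ (hγU hz)).comp (hγ z hz)))
        fun i _ => IsFlat.sum hD _ (fun k _ z hz =>
        (analyticAt_snd.pow _).smul (((hZ i).lieVF (hJZ k) _ (hγU hz)).comp (hγ z hz)))
        fun k hk => ?_
      have hle : N ≤ i + k := by
        have := (Finset.mem_Ico.mp hk).1
        omega
      refine (isFlat_pow_smul (N := N) hD (f := fun z => z.2 ^ (i + k - N) •
        lieVF (Z i) (Jvf J (Z k)) (γ z)) fun z hz => (analyticAt_snd.pow _).smul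
        (((hZ i).lieVF (hJZ k) _ (hγU hz)).comp (hγ z hz))).congr hD fun z _ => ?_
      simp only [smul_smul]
      rw [← pow_add, Nat.add_sub_cancel' hle]
    have a2 : ∀ k, AnalyticOnNhd ℝ (fun z => fderiv ℝ (Jvf J (Z k)) (γ z) (e z)) D :=
      fun k z hz => (hdJZ k z hz).clm_apply_field (he z hz)
    have b2 : AnalyticOnNhd ℝ (fun z => ∑ k ∈ Finset.range N, z.2 ^ k •
        fderiv ℝ (Jvf J (Z k)) (γ z) (e z)) D := fun z hz =>
      Finset.analyticAt_fun_sum _ fun k _ => (analyticAt_snd.pow _).smul (a2 k z hz)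
    have f2 : IsFlat D N (fun z => ∑ k ∈ Finset.range N, z.2 ^ k •
        fderiv ℝ (Jvf J (Z k)) (γ z) (e z)) :=
      IsFlat.sum hD _ (fun k _ z hz => (analyticAt_snd.pow _).smul (a2 k z hz)) fun k _ =>
        (ih.clm_apply hD (hdJZ k) he).pow_mul_smul hD (a2 k) k
    have a3 : ∀ k, AnalyticOnNhd ℝ (fun z => fderiv ℝ (Z k) (γ z) (H z)) D :=
      fun k z hz => (hdZ k z hz).clm_apply_field (hH z hz)
    have b3 : AnalyticOnNhd ℝ (fun z => ∑ k ∈ Finset.range N, z.2 ^ k •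
        fderiv ℝ (Z k) (γ z) (H z)) D := fun z hz =>
      Finset.analyticAt_fun_sum _ fun k _ => (analyticAt_snd.pow _).smul (a3 k z hz)
    have f3 : IsFlat D N (fun z => ∑ k ∈ Finset.range N, z.2 ^ k •
        fderiv ℝ (Z k) (γ z) (H z)) :=
      IsFlat.sum hD _ (fun k _ z hz => (analyticAt_snd.pow _).smul (a3 k z hz)) fun k _ =>
        (ihH.clm_apply hD (hdZ k) hH).pow_mul_smul hD (a3 k) k
    have a4 := hH.fderiv_apply_const (1, 0)
    have f4 := ihH.fderiv_fst hD hH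
    have a5 : AnalyticOnNhd ℝ (fun z => fderiv ℝ (Z N) (γ z) (fderiv ℝ γ z (0, 1))) D :=
      fun z hz => (hdZ N z hz).clm_apply_field (hγ.fderiv_apply_const _ z hz)
    have b5 : AnalyticOnNhd ℝ
        (fun z => z.2 ^ N • fderiv ℝ (Z N) (γ z) (fderiv ℝ γ z (0, 1))) D :=
      fun z hz => (analyticAt_snd.pow _).smul (a5 z hz)
    have f5 := isFlat_pow_smul (N := N) hD a5
    refine ⟨fun x hx => ?_, ((((f1.add hD a1 b2 f2).add hD (a1.add b2) a4 f4).sub hD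
      ((a1.add b2).add a4) b3 f3).sub hD (((a1.add b2).add a4).sub b3) b5 f5).congr hD
      fun z hz => ?_⟩
    · rw [jetRemainder, hγX x hx, Finset.sum_range_succ']
      simp
    · have hγz := (hγ z hz).differentiableAt
      have hx : fderiv ℝ (fun z => fderiv ℝ γ z (0, 1)) z (1, 0) =
          ∑ k ∈ Finset.range N, z.2 ^ k •
            fderiv ℝ (Jvf J (Z k)) (γ z) (fderiv ℝ γ z (1, 0)) + fderiv ℝ H z (1, 0) := by
        have hd : ∀ k, DifferentiableAt ℝ (fun z => z.2 ^ k • Jvf J (Z k) (γ z)) z := fun k =>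
          ((analyticAt_snd.pow k).smul ((hJZ k _ (hγU hz)).comp (hγ z hz))).differentiableAt
        rw [fderiv_eqOn hD (g := fun z => ∑ i ∈ Finset.range N, z.2 ^ i • Jvf J (Z i) (γ z) + H z)
          (fun z hz => hw z hz) hz, fderiv_fun_add
          (DifferentiableAt.fun_sum fun k _ => hd k) (hH z hz).differentiableAt,
          fderiv_fun_sum fun k _ => hd k]
        simp only [add_apply, sum_apply]
        simp [fderiv_pow_smul_comp hγz (hJZ _ _ (hγU hz)).differentiableAt]
      have hsym : fderiv ℝ (fun z => fderiv ℝ γ z (1, 0)) z (0, 1) =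
          fderiv ℝ (fun z => fderiv ℝ γ z (0, 1)) z (1, 0) := by
        have hd := (hγ.fderiv z hz).differentiableAt
        have hs := (hγ z hz).contDiffAt.isSymmSndFDerivAt_of_omega (0, 1) (1, 0)
        rw [fderiv_clm_apply hd (differentiableAt_const _),
          fderiv_clm_apply hd (differentiableAt_const _)]
        simpa using hs
      have hd : ∀ k, DifferentiableAt ℝ (fun z => z.2 ^ k • Z k (γ z)) z := fun k =>
          ((analyticAt_snd.pow k).smul ((hZ k _ (hγU hz)).comp (hγ z hz))).differentiableAt
      have hy : fderiv ℝ (jetRemainder Z γ (N + 1)) z (0, 1) =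
          fderiv ℝ (fun z => fderiv ℝ γ z (1, 0)) z (0, 1) -
          (∑ m ∈ Finset.range N, z.2 ^ m • ((m : ℝ) + 1) • Z (m + 1) (γ z) +
            ∑ k ∈ Finset.range N, z.2 ^ k • fderiv ℝ (Z k) (γ z) (fderiv ℝ γ z (0, 1)) +
            z.2 ^ N • fderiv ℝ (Z N) (γ z) (fderiv ℝ γ z (0, 1))) := by
        change fderiv ℝ (fun z => fderiv ℝ γ z (1, 0) -
          ∑ k ∈ Finset.range (N + 1), z.2 ^ k • Z k (γ z)) z (0, 1) = _
        rw [fderiv_fun_sub (hγ.fderiv_apply_const (1, 0) z hz).differentiableAt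
          (DifferentiableAt.fun_sum fun k _ => hd k), fderiv_fun_sum fun k _ => hd k]
        simp only [sub_apply, sum_apply]
        congr 1
        simp only [fderiv_pow_smul_comp hγz (hZ _ _ (hγU hz)).differentiableAt,
          Finset.sum_add_distrib]
        rw [Finset.sum_range_succ', Finset.sum_range_succ (fun k =>
          z.2 ^ k • fderiv ℝ (Z k) (γ z) (fderiv ℝ γ z (0, 1)))]
        simp [smul_smul, mul_comm, add_assoc]
      have hu' : ∑ k ∈ Finset.range N, z.2 ^ k •
          fderiv ℝ (Jvf J (Z k)) (γ z) (fderiv ℝ γ z (1, 0)) =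
          ∑ i ∈ Finset.range N, ∑ k ∈ Finset.range N, z.2 ^ (i + k) •
            fderiv ℝ (Jvf J (Z k)) (γ z) (Z i (γ z)) +
          ∑ k ∈ Finset.range N, z.2 ^ k • fderiv ℝ (Jvf J (Z k)) (γ z) (e z) := by
        rw [Finset.sum_comm, ← Finset.sum_add_distrib]
        refine Finset.sum_congr rfl fun k _ => ?_
        rw [hu z, map_add, map_sum, smul_add, Finset.smul_sum]
        simp only [map_smul, smul_smul, pow_add, mul_comm]
      have hw' : ∑ k ∈ Finset.range N, z.2 ^ k •
          fderiv ℝ (Z k) (γ z) (fderiv ℝ γ z (0, 1)) =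
          ∑ i ∈ Finset.range N, ∑ k ∈ Finset.range N, z.2 ^ (i + k) •
            fderiv ℝ (Z i) (γ z) (Jvf J (Z k) (γ z)) +
          ∑ k ∈ Finset.range N, z.2 ^ k • fderiv ℝ (Z k) (γ z) (H z) := by
        rw [← Finset.sum_add_distrib]
        refine Finset.sum_congr rfl fun k _ => ?_
        rw [hw z hz, map_add, map_sum, smul_add, Finset.smul_sum]
        simp only [map_smul, smul_smul, pow_add]
      have hdiag := sum_sum_range_pow_smul N z.2
        fun i k => lieVF (Z i) (Jvf J (Z k)) (γ z)
      simp only [← hrec] at hdiag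
      have hsplit : ∑ i ∈ Finset.range N, ∑ k ∈ Finset.range N, z.2 ^ (i + k) •
          lieVF (Z i) (Jvf J (Z k)) (γ z) =
          ∑ i ∈ Finset.range N, ∑ k ∈ Finset.range N, z.2 ^ (i + k) •
            fderiv ℝ (Jvf J (Z k)) (γ z) (Z i (γ z)) -
          ∑ i ∈ Finset.range N, ∑ k ∈ Finset.range N, z.2 ^ (i + k) •
            fderiv ℝ (Z i) (γ z) (Jvf J (Z k) (γ z)) := by
        simp only [← Finset.sum_sub_distrib, ← smul_sub]
        rfl
      simp only [Pi.add_apply, Pi.sub_apply]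
      rw [hy, hsym, hx, hu', hw', eq_sub_of_add_eq' hdiag.symm, hsplit]
      abel

lemma isFlat_fderiv_fst_sub_jetField [CompleteSpace F] (S : IsIntegrableHypersurface U J φ)
    {X : F → F} (hX : IsLeviKernel U J φ X) (hD : IsOpen D) (hγ : AnalyticOnNhd ℝ γ D)
    (hγU : Set.MapsTo γ D U)
    (hγJ : ∀ z ∈ D, fderiv ℝ γ z (0, 1) = J (γ z) (fderiv ℝ γ z (1, 0)))
    (hγX : ∀ x : ℝ, (x, (0 : ℝ)) ∈ D → fderiv ℝ γ (x, 0) (1, 0) = X (γ (x, 0))) (N : ℕ) :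
    IsFlat D N (jetRemainder (jetField J X) γ N) := by
  refine isFlat_jetRemainder hD S.analytic_J (fun k => (hX.jetField S k).isTangent.analytic)
    (fun m q => ?_) hγ hγU hγJ (by simpa only [jetField_zero] using hγX) N
  rw [jetField_succ, Pi.smul_apply, smul_smul, mul_inv_cancel₀ (by positivity), one_smul,
    Finset.sum_apply, Finset.sum_range fun i =>
      lieVF (jetField J X i) (Jvf J (jetField J X (m - i))) q]

end Jets

lemma eq_zero_of_forall_deriv {s : Set ℝ} (hs : IsOpen s) (hc : IsPreconnected s) (h0 : 0 ∈ s)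
    (P : (ℝ → ℝ) → Prop) (hP : ∀ g, P g → AnalyticOnNhd ℝ g s ∧ g 0 = 0 ∧
      ∃ h, P h ∧ ∀ t ∈ s, HasDerivAt g (h t) t) {g : ℝ → ℝ} (hg : P g) {t : ℝ} (ht : t ∈ s) :
    g t = 0 := by
  have key : ∀ n : ℕ, ∀ g, P g → iteratedDeriv n g 0 = 0 := by
    intro n
    induction n with
    | zero => exact fun g hg => by simpa using (hP g hg).2.1
    | succ n ih =>
      intro g hg
      obtain ⟨-, -, h, hh, hd⟩ := hP g hg
      have : deriv g =ᶠ[nhds 0] h := by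
        filter_upwards [hs.mem_nhds h0] with t ht
        exact (hd t ht).deriv
      rw [iteratedDeriv_succ', this.iteratedDeriv_eq, ih h hh]
  have han := (hP g hg).1
  have hps := (han 0 h0).hasFPowerSeriesAt
  have h : (FormalMultilinearSeries.ofScalars ℝ fun n =>
      iteratedDeriv n g 0 / n.factorial) = 0 := by
    ext n
    simp [key n g hg, FormalMultilinearSeries.ofScalars]
  rw [h] at hps
  have hev := hps.eventually_eq_zero
  exact han.eqOn_zero_of_preconnected_of_eventuallyEq_zero hc h0 hev ht

/-- Analytic functions on `U` vanishing on `{φ = 0}`. -/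
structure VanishesOn (U : Set F) (φ f : F → ℝ) : Prop where
  analytic : AnalyticOnNhd ℝ f U
  eq_zero : ∀ q ∈ U, φ q = 0 → f q = 0

lemma VanishesOn.fderiv_apply [CompleteSpace F] (S : IsIntegrableHypersurface U J φ)
    {f : F → ℝ} (hf : VanishesOn U φ f) {Y : F → F} (hY : IsTangent U J φ Y) :
    VanishesOn U φ (fun q => fderiv ℝ f q (Y q)) where
  analytic q hq := (hf.analytic.fderiv q hq).clm_apply_field (hY.analytic q hq)
  eq_zero q hq hφ := S.fderiv_eq_zero_of_vanishing hf.analytic hf.eq_zero hq hφ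
    (hY.inTJM q hq hφ).1

section Vanishing

variable {γ : ℝ × ℝ → F} {ρ : ℝ}

lemma mem_ball_prod_iff {x y : ℝ} :
    (x, y) ∈ ball (0 : ℝ × ℝ) ρ ↔ x ∈ ball (0 : ℝ) ρ ∧ y ∈ ball (0 : ℝ) ρ := by
  simp [Prod.norm_def]

lemma VanishesOn.comp_eq_zero [CompleteSpace F] (S : IsIntegrableHypersurface U J φ) {X : F → F}
    (hX : IsTangent U J φ X) (hρ : 0 < ρ) (hγ : AnalyticOnNhd ℝ γ (ball 0 ρ))
    (hγU : Set.MapsTo γ (ball 0 ρ) U) (h0 : φ (γ 0) = 0)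
    (hγX : ∀ x : ℝ, (x, (0 : ℝ)) ∈ ball (0 : ℝ × ℝ) ρ →
      fderiv ℝ γ (x, 0) (1, 0) = X (γ (x, 0)))
    {f : F → ℝ} (hf : VanishesOn U φ f) {x : ℝ} (hx : (x, (0 : ℝ)) ∈ ball (0 : ℝ × ℝ) ρ) :
    f (γ (x, 0)) = 0 := by
  have hmem : ∀ x ∈ ball (0 : ℝ) ρ, (x, (0 : ℝ)) ∈ ball (0 : ℝ × ℝ) ρ := fun x hx =>
    mem_ball_prod_iff.mpr ⟨hx, mem_ball_self hρ⟩
  refine eq_zero_of_forall_deriv isOpen_ball (convex_ball (0 : ℝ) ρ).isPreconnected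
    (mem_ball_self hρ) (fun g => ∃ f, VanishesOn U φ f ∧ g = fun x => f (γ (x, 0)))
    ?_ ⟨f, hf, rfl⟩ (mem_ball_prod_iff.mp hx).1
  rintro _ ⟨f, hf, rfl⟩
  refine ⟨fun x hx => ?_, hf.eq_zero _ (hγU (mem_ball_self hρ)) h0, _,
    ⟨_, hf.fderiv_apply S hX, rfl⟩, fun x hx => ?_⟩
  · exact ((hf.analytic _ (hγU (hmem x hx))).comp (hγ _ (hmem x hx))).comp
      (f := fun x : ℝ => (x, (0 : ℝ))) (analyticAt_id.prod analyticAt_const)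
  · have hl : HasDerivAt (fun s : ℝ => (s, (0 : ℝ))) ((1 : ℝ), (0 : ℝ)) x :=
      (hasDerivAt_id _).prodMk (hasDerivAt_const _ _)
    have h1 := (hγ _ (hmem x hx)).differentiableAt.hasFDerivAt.comp_hasDerivAt x hl
    have h2 := (hf.analytic _ (hγU (hmem x hx))).differentiableAt.hasFDerivAt.comp_hasDerivAt x h1
    rw [hγX x (hmem x hx)] at h2
    exact h2

lemma VanishesOn.isFlat_comp [CompleteSpace F] (S : IsIntegrableHypersurface U J φ) {X : F → F}
    (hX : IsLeviKernel U J φ X) (hρ : 0 < ρ) (hγ : AnalyticOnNhd ℝ γ (ball 0 ρ))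
    (hγU : Set.MapsTo γ (ball 0 ρ) U) (h0 : φ (γ 0) = 0)
    (hγJ : ∀ z ∈ ball (0 : ℝ × ℝ) ρ, fderiv ℝ γ z (0, 1) = J (γ z) (fderiv ℝ γ z (1, 0)))
    (hγX : ∀ x : ℝ, (x, (0 : ℝ)) ∈ ball (0 : ℝ × ℝ) ρ →
      fderiv ℝ γ (x, 0) (1, 0) = X (γ (x, 0))) (N : ℕ)
    {f : F → ℝ} (hf : VanishesOn U φ f) : IsFlat (ball 0 ρ) N (fun z => f (γ z)) := by
  have hD : IsOpen (ball (0 : ℝ × ℝ) ρ) := isOpen_ball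
  have hZ := hX.jetField S
  induction N generalizing f with
  | zero => trivial
  | succ N ih =>
    refine ⟨fun x hx => hf.comp_eq_zero S hX.isTangent hρ hγ hγU h0 hγX hx, ?_⟩
    have hR := isFlat_fderiv_fst_sub_jetField S hX hD hγ hγU hγJ hγX N
    have hRa := analyticOnNhd_jetRemainder hγ hγU (fun k => (hZ k).isTangent.analytic) N
    have hdf : AnalyticOnNhd ℝ (fun z => fderiv ℝ f (γ z)) (ball 0 ρ) :=
      hf.analytic.fderiv.comp hγ hγU
    have hJγ : AnalyticOnNhd ℝ (fun z => J (γ z)) (ball 0 ρ) := S.analytic_J.comp hγ hγU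
    have hJR : AnalyticOnNhd ℝ
        (fun z => J (γ z) (jetRemainder (jetField J X) γ N z)) (ball 0 ρ) :=
      fun z hz => (hJγ z hz).clm_apply_field (hRa z hz)
    have hV : ∀ k, VanishesOn U φ (fun q => fderiv ℝ f q (Jvf J (jetField J X k) q)) :=
      fun k => hf.fderiv_apply S ((hZ k).isTangent.Jvf S)
    have hVa : ∀ k, AnalyticOnNhd ℝ
        (fun z => fderiv ℝ f (γ z) (Jvf J (jetField J X k) (γ z))) (ball 0 ρ) :=
      fun k => (hV k).analytic.comp hγ hγU
    have hsa : ∀ k, AnalyticOnNhd ℝ (fun z => z.2 ^ k •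
        fderiv ℝ f (γ z) (Jvf J (jetField J X k) (γ z))) (ball 0 ρ) :=
      fun k z hz => (analyticAt_snd.pow k).smul (hVa k z hz)
    refine ((IsFlat.sum hD (Finset.range N) (fun k _ => hsa k)
      fun k _ => (ih (hV k)).pow_mul_smul hD (hVa k) k).add hD
      (fun z hz => Finset.analyticAt_fun_sum _ fun k _ => hsa k z hz)
      (fun z hz => (hdf z hz).clm_apply_field (hJR z hz))
      ((hR.clm_apply hD hJγ hRa).clm_apply hD hdf hJR)).congr hD fun z hz => ?_
    have hc := ((hf.analytic _ (hγU hz)).differentiableAt.hasFDerivAt.comp z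
      (hγ z hz).differentiableAt.hasFDerivAt).fderiv
    have hu : fderiv ℝ γ z (1, 0) = ∑ k ∈ Finset.range N, z.2 ^ k • jetField J X k (γ z) +
        jetRemainder (jetField J X) γ N z := by
      simp [jetRemainder]
    change _ = fderiv ℝ (f ∘ γ) z (0, 1)
    rw [hc, ContinuousLinearMap.comp_apply, hγJ z hz, hu]
    simp [Jvf]

lemma isFlat_all_eq_zero (hρ : 0 < ρ) {f : ℝ × ℝ → ℝ} (hf : AnalyticOnNhd ℝ f (ball 0 ρ))
    (hflat : ∀ N, IsFlat (ball 0 ρ) N f) {z : ℝ × ℝ} (hz : z ∈ ball (0 : ℝ × ℝ) ρ) :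
    f z = 0 := by
  obtain ⟨x, y⟩ := z
  obtain ⟨hx, hy⟩ := mem_ball_prod_iff.mp hz
  have hmem : ∀ y ∈ ball (0 : ℝ) ρ, (x, y) ∈ ball (0 : ℝ × ℝ) ρ := fun y hy =>
    mem_ball_prod_iff.mpr ⟨hx, hy⟩
  refine eq_zero_of_forall_deriv isOpen_ball (convex_ball (0 : ℝ) ρ).isPreconnected
    (mem_ball_self hρ) (fun g => ∃ f, AnalyticOnNhd ℝ f (ball 0 ρ) ∧
      (∀ N, IsFlat (ball 0 ρ) N f) ∧ g = fun y => f (x, y)) ?_ ⟨f, hf, hflat, rfl⟩ hy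
  rintro _ ⟨f, hf, hflat, rfl⟩
  refine ⟨fun y hy => ?_, (hflat 1).1 x (hmem 0 (mem_ball_self hρ)), _,
    ⟨_, hf.fderiv_apply_const (0, 1), fun N => (hflat (N + 1)).2, rfl⟩, fun y hy => ?_⟩
  · exact (hf _ (hmem y hy)).comp (f := fun y : ℝ => (x, y)) (analyticAt_const.prod analyticAt_id)
  · have hl : HasDerivAt (fun s : ℝ => (x, s)) ((0 : ℝ), (1 : ℝ)) y :=
      (hasDerivAt_const _ _).prodMk (hasDerivAt_id _)
    exact (hf _ (hmem y hy)).differentiableAt.hasFDerivAt.comp_hasDerivAt y hl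

end Vanishing

lemma exists_JHolOn_disc [FiniteDimensional ℝ F] (S : IsIntegrableHypersurface U J φ) {X : F → F}
    (hX : IsLeviKernel U J φ X) {p : F} (hp : p ∈ U) (hφ : φ p = 0) :
    ∃ ρ > (0 : ℝ), ∃ γ : ℂ → F, AnalyticOnNhd ℝ γ (ball 0 ρ) ∧ JHolOn J (ball 0 ρ) γ ∧
      γ 0 = p ∧ deriv (fun t : ℝ => γ t) 0 = X p ∧
      ∀ ζ ∈ ball (0 : ℂ) ρ, γ ζ ∈ U ∧ φ (γ ζ) = 0 := by
  have : CompleteSpace F := FiniteDimensional.complete ℝ F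
  obtain ⟨r, hr, γ, hγ, h0, hγJ, hγX⟩ :=
    exists_analytic_curve (S.analytic_J p hp) (hX.isTangent.analytic p hp)
  have hc : γ ⁻¹' U ∈ nhds 0 := (hγ 0 (mem_ball_self hr)).continuousAt.preimage_mem_nhds
    (h0 ▸ S.isOpen.mem_nhds hp)
  obtain ⟨s, hs, hsU⟩ := Metric.mem_nhds_iff.mp hc
  obtain ⟨ρ, hρ, hρr, hρs⟩ : ∃ ρ > 0, ρ ≤ r ∧ ρ ≤ s :=
    ⟨min r s, lt_min hr hs, min_le_left _ _, min_le_right _ _⟩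
  have hγ' : AnalyticOnNhd ℝ γ (ball 0 ρ) := hγ.mono (ball_subset_ball hρr)
  have hγU : Set.MapsTo γ (ball 0 ρ) U := fun z hz => hsU (ball_subset_ball hρs hz)
  have hγJ' := fun z (hz : z ∈ ball (0 : ℝ × ℝ) ρ) => hγJ z (ball_subset_ball hρr hz)
  have hγX' := fun x (hx : (x, (0 : ℝ)) ∈ ball (0 : ℝ × ℝ) ρ) =>
    hγX x (ball_subset_ball hρr hx)
  have hφγ : ∀ z ∈ ball (0 : ℝ × ℝ) ρ, φ (γ z) = 0 := fun z hz =>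
    isFlat_all_eq_zero hρ (S.analytic_φ.comp hγ' hγU) (fun N =>
      VanishesOn.isFlat_comp S hX hρ hγ' hγU (h0 ▸ hφ) hγJ' hγX' N
        ⟨S.analytic_φ, fun _ _ h => h⟩) hz
  let L : ℂ →L[ℝ] ℝ × ℝ := Complex.reCLM.prod Complex.imCLM
  have hL : ∀ ζ ∈ ball (0 : ℂ) ρ, L ζ ∈ ball (0 : ℝ × ℝ) ρ := fun ζ hζ => by
    rw [mem_ball_zero_iff] at hζ ⊢
    exact max_lt ((Complex.abs_re_le_norm ζ).trans_lt hζ) ((Complex.abs_im_le_norm ζ).trans_lt hζ)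
  refine ⟨ρ, hρ, fun ζ => γ (L ζ), fun ζ hζ => (hγ' _ (hL ζ hζ)).comp (L.analyticAt ζ),
    fun ζ hζ v => ?_, by simpa using h0, ?_,
    fun ζ hζ => ⟨hγU (hL ζ hζ), hφγ _ (hL ζ hζ)⟩⟩
  · have h1 : fderiv ℝ (fun ζ => γ (L ζ)) ζ = (fderiv ℝ γ (L ζ)).comp L :=
      ((hγ' _ (hL ζ hζ)).differentiableAt.hasFDerivAt.comp ζ L.hasFDerivAt).fderiv
    have h2 : ∀ a b : ℝ, fderiv ℝ γ (L ζ) (a, b) =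
        a • fderiv ℝ γ (L ζ) (1, 0) + b • J (γ (L ζ)) (fderiv ℝ γ (L ζ) (1, 0)) := by
      intro a b
      rw [← hγJ' _ (hL ζ hζ), ← map_smul, ← map_smul, ← map_add]
      simp
    have h3 : ∀ v : ℂ, L v = (v.re, v.im) := fun v => rfl
    rw [h1, ContinuousLinearMap.comp_apply, ContinuousLinearMap.comp_apply, h3 (Complex.I * v),
      h3 v, h2 v.re v.im, h2]
    simp only [map_add, map_smul, S.sq_apply (hγU (hL ζ hζ))]
    simp [add_comm]
  · have hl : HasDerivAt (fun s : ℝ => (s, (0 : ℝ))) ((1 : ℝ), (0 : ℝ)) 0 :=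
      (hasDerivAt_id _).prodMk (hasDerivAt_const _ _)
    have h1 := HasFDerivAt.comp_hasDerivAt (f := fun s : ℝ => (s, (0 : ℝ))) (0 : ℝ)
      (hγ' 0 (mem_ball_self hρ)).differentiableAt.hasFDerivAt hl
    have h2 := h1.deriv
    have h3 := hγX' 0 (mem_ball_self hρ)
    rw [← h0]
    exact h2.trans h3

open scoped ContDiff in
/-- Theorem 4.6, generalization of Freeman's theorem in the integrable case. -/
theorem stmt4 (n : ℕ) (U : Set (Ecx n)) (hU : IsOpen U) (h0U : (0 : Ecx n) ∈ U)
    (J : Ecx n → Ecx n →L[ℝ] Ecx n) (hJan : AnalyticOnNhd ℝ J U)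
    (hJsq : ∀ x ∈ U, (J x).comp (J x) = -ContinuousLinearMap.id ℝ (Ecx n))
    (hJ0 : J 0 = J0 n)
    (hint : ∀ Y Z : Ecx n → Ecx n, ContDiff ℝ ∞ Y → ContDiff ℝ ∞ Z → ∀ q ∈ U,
      lieVF (Jvf J Y) (Jvf J Z) q - J q (lieVF (Jvf J Y) Z q) - J q (lieVF Y (Jvf J Z) q)
        - lieVF Y Z q = 0)
    (φ : Ecx n → ℝ) (hφan : AnalyticOnNhd ℝ φ U) (hφ0 : φ 0 = 0)
    (hdφ : ∀ q ∈ U, φ q = 0 → fderiv ℝ φ q ≠ 0)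
    (X : Ecx n → Ecx n) (hXan : AnalyticOnNhd ℝ X U)
    (hXtan : InTJM J φ U X)
    (hker : ∀ Y : Ecx n → Ecx n, AnalyticOnNhd ℝ Y U → InTJM J φ U Y →
      ∀ q ∈ U, φ q = 0 → levihat J φ X Y q = 0) :
    ∃ V ∈ nhds (0 : Ecx n), ∀ p ∈ V, φ p = 0 →
      ∃ ρ > (0 : ℝ), ∃ γ : ℂ → Ecx n,
        AnalyticOnNhd ℝ γ (ball 0 ρ) ∧
        JHolOn J (ball 0 ρ) γ ∧
        γ 0 = p ∧
        deriv (fun t : ℝ => γ t) 0 = X p ∧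
        (∀ ζ ∈ ball (0 : ℂ) ρ, γ ζ ∈ U ∧ φ (γ ζ) = 0) := by
  have : FiniteDimensional ℝ (Ecx n) := FiniteDimensional.complexToReal (Ecx n)
  have : CompleteSpace (Ecx n) := FiniteDimensional.complete ℝ (Ecx n)
  have S : IsIntegrableHypersurface U J φ := ⟨hU, hJan, hJsq, hint, hφan, hdφ⟩
  exact ⟨U, hU.mem_nhds h0U, fun p hp hφp => exists_JHolOn_disc S
    (IsTangent.isLeviKernel S ⟨hXan, hXtan⟩ fun Y hY => hker Y hY.analytic hY.inTJM) hp hφp⟩
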